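/- arXiv:1611.03012 — 13 statements merged into one kernel-verified Lean document; each statement's English description precedes it below -/
import Mathlib

section
/- Let L ≥ 1 and M ≥ 1 be integers and let I_1, …, I_M be nonempty subsets of Z_L. Then the family (I_1, …, I_M) is user-irrepressible if and only if for every i ∈ {1,…,M}, every subset A ⊆ {1,…,M}\{i}, and every choice of shifts τ_j ∈ Z_L for j ∈ A, one has |I_i \ ⋃_{j∈A} (I_j + τ_j)| ≥ M − |A|. -/
/-- The cyclic shift of a subset of `ZMod L` by `τ`. -/
def shiftF {L : ℕ} (S : Finset (ZMod L)) (τ : ZMod L) : Finset (ZMod L) :=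
  S.image (· + τ)

/-- A family `I : Fin M → Finset (ZMod L)` is user-irrepressible (UI) if for every `i`
and every choice of shifts `τ j` for `j ≠ i`, `I i` is not contained in the union of the
shifted versions of the other sequences. -/
def UI {L M : ℕ} (I : Fin M → Finset (ZMod L)) : Prop :=
  ∀ i : Fin M, ∀ τ : Fin M → ZMod L,
    ¬ I i ⊆ (Finset.univ.erase i).biUnion fun j => shiftF (I j) (τ j)

/-- A finset `R` can be covered by one point per index of any at least as large index set `B`. -/
theorem exists_subset_image_of_card_le {α β : Type*} [Nonempty α] [Nonempty β] [DecidableEq α]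
    {R : Finset α} {B : Finset β} (h : R.card ≤ B.card) : ∃ g : β → α, R ⊆ B.image g := by
  obtain ⟨e, he, hinj⟩ := Set.Finite.exists_injOn_of_encard_le (s := (R : Set α))
    (t := (B : Set β)) R.finite_toSet (by simpa [Set.encard_coe_eq_coe_finsetCard] using h)
  refine ⟨Function.invFunOn e R, fun x hx => Finset.mem_image.2 ⟨e x, he hx, ?_⟩⟩
  exact hinj.leftInvOn_invFunOn hx

theorem stmt0 {L M : ℕ} (hL : 1 ≤ L) (hM : 1 ≤ M)
    (I : Fin M → Finset (ZMod L)) (hne : ∀ i, (I i).Nonempty) :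
    UI I ↔ ∀ i : Fin M, ∀ A : Finset (Fin M), A ⊆ Finset.univ.erase i →
      ∀ τ : Fin M → ZMod L,
        M - A.card ≤ (I i \ A.biUnion fun j => shiftF (I j) (τ j)).card := by
  constructor
  · intro hUI i A hA τ
    by_contra! hlt
    set R := I i \ A.biUnion fun j => shiftF (I j) (τ j)
    have hB : R.card ≤ (Finset.univ.erase i \ A).card := by
      rw [Finset.card_sdiff_of_subset hA, Finset.card_erase_of_mem (Finset.mem_univ i),
        Finset.card_univ, Fintype.card_fin]
      omega
    have : Nonempty (Fin M) := ⟨i⟩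
    obtain ⟨g, hg⟩ := exists_subset_image_of_card_le hB
    choose p hp using hne
    refine hUI i (fun j => if j ∈ A then τ j else g j - p j) fun x hx => ?_
    rw [Finset.mem_biUnion]
    by_cases hxA : x ∈ A.biUnion fun j => shiftF (I j) (τ j)
    · obtain ⟨j, hj, hxj⟩ := Finset.mem_biUnion.1 hxA
      exact ⟨j, hA hj, by simpa [hj] using hxj⟩
    · obtain ⟨j, hj, rfl⟩ := Finset.mem_image.1 (hg (Finset.mem_sdiff.2 ⟨hx, hxA⟩))
      obtain ⟨hji, hjA⟩ := Finset.mem_sdiff.1 hj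
      exact ⟨j, hji, Finset.mem_image.2 ⟨p j, hp j, by simp [hjA]⟩⟩
  · intro h i τ hsub
    have hcard := h i _ subset_rfl τ
    rw [Finset.sdiff_eq_empty_iff_subset.2 hsub, Finset.card_empty,
      Finset.card_erase_of_mem (Finset.mem_univ i), Finset.card_univ, Fintype.card_fin] at hcard
    omega
end

section
/- Let M ≥ 2 and let (I_1, …, I_M) be subsets of Z_L, each of Hamming weight M+1. Then (I_1, …, I_M) is user-irrepressible if and only if for every i ∈ {1,…,M}: (i) H_{I_i,I_j} ≤ 2 for every j ≠ i; and (ii) for all distinct j, k ∈ {1,…,M}\{i} such that k ∈ B_i and every τ_k ∈ T_{i,k}, one has H_{I_{i,k,τ_k},I_j} ≤ 1 (equivalently, d*(I_{i,k,τ_k}) ∩ d*(I_j) = ∅). -/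
/-- Hamming cross-correlation of `I₁` and `I₂` at relative shift `τ`. -/
def Hcc {L : ℕ} (I₁ I₂ : Finset (ZMod L)) (τ : ZMod L) : ℕ :=
  (I₁ ∩ shiftF I₂ τ).card

/-- Maximum Hamming cross-correlation of `I₁` and `I₂` over all shifts. -/
def Hmax {L : ℕ} [NeZero L] (I₁ I₂ : Finset (ZMod L)) : ℕ :=
  Finset.univ.sup (Hcc I₁ I₂)

/-- `Bset I i` is the set of indices `k ≠ i` maximizing `Hmax (I i) (I k)`. -/
def Bset {L M : ℕ} [NeZero L] (I : Fin M → Finset (ZMod L)) (i : Fin M) :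
    Finset (Fin M) :=
  (Finset.univ.erase i).filter fun k =>
    ∀ j ∈ Finset.univ.erase i, Hmax (I i) (I j) ≤ Hmax (I i) (I k)

/-- `Tset I₁ I₂` is the set of relative shifts achieving the maximum cross-correlation. -/
def Tset {L : ℕ} [NeZero L] (I₁ I₂ : Finset (ZMod L)) : Finset (ZMod L) :=
  Finset.univ.filter fun τ => Hcc I₁ I₂ τ = Hmax I₁ I₂

/-- The set of nonzero differences of elements of `S`. -/
def dstar {L : ℕ} (S : Finset (ZMod L)) : Finset (ZMod L) :=
  ((S ×ˢ S).filter fun p => p.1 ≠ p.2).image fun p => p.1 - p.2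

theorem Hcc_le_Hmax {L : ℕ} [NeZero L] (S T : Finset (ZMod L)) (τ : ZMod L) :
    Hcc S T τ ≤ Hmax S T :=
  Finset.le_sup (f := Hcc S T) (Finset.mem_univ τ)

theorem exists_Hcc_eq_Hmax {L : ℕ} [NeZero L] (S T : Finset (ZMod L)) :
    ∃ τ, Hcc S T τ = Hmax S T := by
  obtain ⟨τ, -, h⟩ := Finset.exists_mem_eq_sup Finset.univ Finset.univ_nonempty (Hcc S T)
  exact ⟨τ, h.symm⟩

theorem Hmax_mono_left {L : ℕ} [NeZero L] {S S' : Finset (ZMod L)} (h : S ⊆ S')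
    (T : Finset (ZMod L)) : Hmax S T ≤ Hmax S' T :=
  Finset.sup_mono_fun fun _ _ => Finset.card_le_card (Finset.inter_subset_inter_right h)

theorem card_sdiff_shiftF_add_Hcc {L : ℕ} (S T : Finset (ZMod L)) (τ : ZMod L) :
    (S \ shiftF T τ).card + Hcc S T τ = S.card :=
  Finset.card_sdiff_add_card_inter S (shiftF T τ)

theorem dstar_inter_dstar_eq_empty {L : ℕ} [NeZero L] {S T : Finset (ZMod L)}
    (h : Hmax S T ≤ 1) : dstar S ∩ dstar T = ∅ := by
  by_contra! hne
  obtain ⟨x, hx⟩ := hne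
  simp only [dstar, Finset.mem_inter, Finset.mem_image, Finset.mem_filter,
    Finset.mem_product, Prod.exists] at hx
  obtain ⟨⟨a, b, ⟨⟨ha, hb⟩, hab⟩, rfl⟩, c, d, ⟨⟨hc, hd⟩, -⟩, hcd⟩ := hx
  refine hab (Finset.card_le_one.mp ((Hcc_le_Hmax S T (a - c)).trans h) a ?_ b ?_)
  · exact Finset.mem_inter.mpr ⟨ha, Finset.mem_image.mpr ⟨c, hc, by ring⟩⟩
  · exact Finset.mem_inter.mpr
      ⟨hb, Finset.mem_image.mpr ⟨d, hd, by linear_combination -hcd⟩⟩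

/-- At most `J.card` points can be covered by shifts of nonempty sets indexed by `J`. -/
theorem exists_shifts_cover {L : ℕ} {ι : Type*} [DecidableEq ι] (I : ι → Finset (ZMod L))
    (hI : ∀ j, (I j).Nonempty) (J : Finset ι) (A : Finset (ZMod L)) (h : A.card ≤ J.card) :
    ∃ τ : ι → ZMod L, A ⊆ J.biUnion fun j => shiftF (I j) (τ j) := by
  obtain ⟨J', hJ', hcard⟩ := Finset.exists_subset_card_eq h
  let e := Finset.equivOfCardEq hcard
  choose p hp using hI
  refine ⟨fun j => if hj : j ∈ J' then (e ⟨j, hj⟩ : ZMod L) - p j else 0, fun a ha => ?_⟩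
  refine Finset.mem_biUnion.mpr ⟨e.symm ⟨a, ha⟩, hJ' (e.symm ⟨a, ha⟩).2, ?_⟩
  exact Finset.mem_image.mpr ⟨p _, hp _, by simp⟩

/-- If shifts of the sets indexed by `J` leave at most as many points of `I i` uncovered as there
are further sets available, then the family is not user-irrepressible. -/
theorem UI.card_lt_card_sdiff_biUnion {L M : ℕ} {I : Fin M → Finset (ZMod L)} (hUI : UI I)
    (hI : ∀ j, (I j).Nonempty) {i : Fin M} {J : Finset (Fin M)} (hJ : i ∉ J)
    (σ : Fin M → ZMod L) :
    (Finset.univ.erase i \ J).card < (I i \ J.biUnion fun j => shiftF (I j) (σ j)).card := by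
  by_contra! hle
  obtain ⟨τ, hτ⟩ := exists_shifts_cover I hI _ _ hle
  refine hUI i (fun j => if j ∈ J then σ j else τ j) fun a ha => ?_
  by_cases hmem : a ∈ J.biUnion fun j => shiftF (I j) (σ j)
  · obtain ⟨j, hj, haj⟩ := Finset.mem_biUnion.mp hmem
    refine Finset.mem_biUnion.mpr ⟨j, ?_, by simpa only [hj, if_true] using haj⟩
    exact Finset.mem_erase.mpr ⟨fun h => hJ (h ▸ hj), Finset.mem_univ j⟩
  · obtain ⟨j, hj, haj⟩ := Finset.mem_biUnion.mp (hτ (Finset.mem_sdiff.mpr ⟨ha, hmem⟩))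
    obtain ⟨hj, hjJ⟩ := Finset.mem_sdiff.mp hj
    exact Finset.mem_biUnion.mpr ⟨j, hj, by simpa only [hjJ, if_false] using haj⟩

theorem card_le_sum_Hcc {L : ℕ} {ι : Type*} [DecidableEq ι] (I : ι → Finset (ZMod L))
    {J : Finset ι} {A : Finset (ZMod L)} {τ : ι → ZMod L}
    (h : A ⊆ J.biUnion fun j => shiftF (I j) (τ j)) : A.card ≤ ∑ j ∈ J, Hcc A (I j) (τ j) := by
  calc A.card = (J.biUnion fun j => A ∩ shiftF (I j) (τ j)).card := by
        rw [← Finset.inter_biUnion, Finset.inter_eq_left.mpr h]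
    _ ≤ ∑ j ∈ J, Hcc A (I j) (τ j) := Finset.card_biUnion_le

theorem UI.Hmax_le_two {L M : ℕ} [NeZero L] {I : Fin M → Finset (ZMod L)} (hUI : UI I)
    (hw : ∀ i, (I i).card = M + 1) {i j : Fin M} (hji : j ≠ i) : Hmax (I i) (I j) ≤ 2 := by
  have hI : ∀ j, (I j).Nonempty := fun j => Finset.card_pos.mp (by have := hw j; omega)
  obtain ⟨τ, hτ⟩ := exists_Hcc_eq_Hmax (I i) (I j)
  have h := hUI.card_lt_card_sdiff_biUnion hI (J := {j}) (by simpa using hji.symm) fun _ => τ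
  rw [Finset.singleton_biUnion, Finset.card_sdiff_of_subset (by simpa using hji),
    Finset.card_erase_of_mem (Finset.mem_univ i)] at h
  simp only [Finset.card_univ, Fintype.card_fin, Finset.card_singleton] at h
  have := card_sdiff_shiftF_add_Hcc (I i) (I j) τ
  have := hw i
  omega

theorem UI.Hmax_sdiff_le_one {L M : ℕ} [NeZero L] {I : Fin M → Finset (ZMod L)} (hUI : UI I)
    (hw : ∀ i, (I i).card = M + 1) {i j k : Fin M} (hji : j ≠ i) (hki : k ≠ i) (hjk : j ≠ k)
    (hk : k ∈ Bset I i) {τ : ZMod L} (hτ : τ ∈ Tset (I i) (I k)) :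
    Hmax (I i \ shiftF (I k) τ) (I j) ≤ 1 := by
  have hI : ∀ j, (I j).Nonempty := fun j => Finset.card_pos.mp (by have := hw j; omega)
  obtain ⟨σ, hσ⟩ := exists_Hcc_eq_Hmax (I i \ shiftF (I k) τ) (I j)
  have h := hUI.card_lt_card_sdiff_biUnion hI (i := i) (J := {k, j})
    (by simp [hki.symm, hji.symm]) fun l => if l = k then τ else σ
  rw [Finset.biUnion_insert, Finset.singleton_biUnion, if_pos rfl, if_neg hjk,
    ← Finset.sup_eq_union, ← sdiff_sdiff_left,
    Finset.card_sdiff_of_subset (by simp [Finset.insert_subset_iff, hji, hki]),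
    Finset.card_erase_of_mem (Finset.mem_univ i), Finset.card_pair hjk.symm] at h
  simp only [Finset.card_univ, Fintype.card_fin] at h
  have := card_sdiff_shiftF_add_Hcc (I i) (I k) τ
  have := card_sdiff_shiftF_add_Hcc (I i \ shiftF (I k) τ) (I j) σ
  have := (Finset.mem_filter.mp hτ).2
  have := (Finset.mem_filter.mp hk).2 j (Finset.mem_erase.mpr ⟨hji, Finset.mem_univ j⟩)
  have := Hmax_mono_left (Finset.sdiff_subset (s := I i) (t := shiftF (I k) τ)) (I j)
  have := hw i
  omega

theorem not_subset_biUnion_shiftF {L M : ℕ} [NeZero L] {I : Fin M → Finset (ZMod L)}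
    (hw : ∀ i, (I i).card = M + 1) {i : Fin M}
    (htwo : ∀ j, j ≠ i → Hmax (I i) (I j) ≤ 2)
    (hone : ∀ j k, j ≠ i → k ≠ i → j ≠ k → k ∈ Bset I i → ∀ τ ∈ Tset (I i) (I k),
      Hmax (I i \ shiftF (I k) τ) (I j) ≤ 1) (τ : Fin M → ZMod L) :
    ¬ I i ⊆ (Finset.univ.erase i).biUnion fun j => shiftF (I j) (τ j) := by
  intro hcov
  have hcard : (Finset.univ.erase i).card = M - 1 := by simp
  obtain ⟨k, hki, hk⟩ : ∃ k ∈ Finset.univ.erase i, 1 < Hcc (I i) (I k) (τ k) := by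
    by_contra! hle
    have := (card_le_sum_Hcc I hcov).trans (Finset.sum_le_card_nsmul _ _ 1 hle)
    rw [hw, hcard, smul_eq_mul] at this
    omega
  have hki' := Finset.ne_of_mem_erase hki
  have hle := Hcc_le_Hmax (I i) (I k) (τ k)
  have htwo_k := htwo k hki'
  have hkB : k ∈ Bset I i := Finset.mem_filter.mpr ⟨hki, fun j hj => by
    have := htwo j (Finset.ne_of_mem_erase hj)
    omega⟩
  have hτT : τ k ∈ Tset (I i) (I k) := Finset.mem_filter.mpr ⟨Finset.mem_univ _, by omega⟩
  have hcov' : I i \ shiftF (I k) (τ k) ⊆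
      ((Finset.univ.erase i).erase k).biUnion fun j => shiftF (I j) (τ j) := by
    intro a ha
    obtain ⟨ha, hak⟩ := Finset.mem_sdiff.mp ha
    obtain ⟨j, hj, haj⟩ := Finset.mem_biUnion.mp (hcov ha)
    exact Finset.mem_biUnion.mpr
      ⟨j, Finset.mem_erase.mpr ⟨fun h => hak (h ▸ haj), hj⟩, haj⟩
  have hsum := (card_le_sum_Hcc I hcov').trans (Finset.sum_le_card_nsmul _ _ 1 fun j hj => by
    obtain ⟨hjk, hj⟩ := Finset.mem_erase.mp hj
    exact (Hcc_le_Hmax _ _ _).trans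
      (hone j k (Finset.ne_of_mem_erase hj) hki' hjk hkB (τ k) hτT))
  rw [Finset.card_erase_of_mem hki, hcard, smul_eq_mul] at hsum
  have := card_sdiff_shiftF_add_Hcc (I i) (I k) (τ k)
  have := hw i
  omega

theorem stmt2 {L M : ℕ} [NeZero L] (hM : 2 ≤ M) (I : Fin M → Finset (ZMod L))
    (hw : ∀ i, (I i).card = M + 1) :
    UI I ↔ ∀ i : Fin M,
      (∀ j : Fin M, j ≠ i → Hmax (I i) (I j) ≤ 2) ∧
      (∀ j k : Fin M, j ≠ i → k ≠ i → j ≠ k → k ∈ Bset I i →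
        ∀ τk ∈ Tset (I i) (I k),
          Hmax (I i \ shiftF (I k) τk) (I j) ≤ 1 ∧
          dstar (I i \ shiftF (I k) τk) ∩ dstar (I j) = ∅) := by
  refine ⟨fun hUI i => ⟨fun j hji => hUI.Hmax_le_two hw hji,
    fun j k hji hki hjk hk τ hτ => ?_⟩, fun h i => ?_⟩
  · have hle := hUI.Hmax_sdiff_le_one hw hji hki hjk hk hτ
    exact ⟨hle, dstar_inter_dstar_eq_empty hle⟩
  · exact not_subset_biUnion_shiftF hw (h i).1
      fun j k hji hki hjk hk τ hτ => ((h i).2 j k hji hki hjk hk τ hτ).1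
end

section
/- Let M ≥ 2 and let (I_1, …, I_M) be a user-irrepressible family of subsets of Z_L, each of Hamming weight M+1. Then for all i ≠ j in {1,…,M} and every τ ∈ Z_L, |I_i ∩ (I_j + τ)| ≤ 2. -/
/-- A set of at most as many points as there are indices in `O` can be covered by shifts of
nonempty sets, one for each index in `O`. -/
theorem exists_shifts_cover_s3 {L : ℕ} {ι : Type*} (I : ι → Finset (ZMod L))
    (hne : ∀ k, (I k).Nonempty) (R : Finset (ZMod L)) (O : Finset ι) (h : R.card ≤ O.card) :
    ∃ σ : ι → ZMod L, ∀ r ∈ R, ∃ k ∈ O, r ∈ shiftF (I k) (σ k) := by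
  classical
  choose a ha using hne
  obtain ⟨e⟩ : Nonempty (R ↪ O) := Function.Embedding.nonempty_of_card_le (by simpa using h)
  have he : Function.Injective fun r : R => (e r : ι) := Subtype.val_injective.comp e.injective
  refine ⟨Function.extend (fun r : R => (e r : ι)) (fun r => (r : ZMod L) - a (e r)) 0,
    fun r hr => ⟨e ⟨r, hr⟩, (e ⟨r, hr⟩).2, Finset.mem_image.mpr ⟨a (e ⟨r, hr⟩), ha _, ?_⟩⟩⟩
  have key := he.extend_apply (fun r => (r : ZMod L) - a (e r)) 0 ⟨r, hr⟩
  dsimp only at key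
  rw [key, add_sub_cancel]

theorem stmt3 {L M : ℕ} (hM : 2 ≤ M) (I : Fin M → Finset (ZMod L))
    (hw : ∀ i, (I i).card = M + 1) (hUI : UI I) :
    ∀ i j : Fin M, i ≠ j → ∀ τ : ZMod L, (I i ∩ shiftF (I j) τ).card ≤ 2 := by
  intro i j hij τ
  by_contra! hlt
  have hne : ∀ k, (I k).Nonempty := fun k => Finset.card_pos.mp (by rw [hw k]; omega)
  have hO : ((Finset.univ.erase i).erase j).card = M - 2 := by
    rw [Finset.card_erase_of_mem (by simp [hij.symm]), Finset.card_erase_of_mem (by simp)]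
    simp [Nat.sub_sub]
  have hR : (I i \ shiftF (I j) τ).card ≤ M - 2 := by
    have h := Finset.card_sdiff_add_card_inter (I i) (shiftF (I j) τ)
    rw [hw i] at h
    omega
  obtain ⟨σ, hσ⟩ := exists_shifts_cover_s3 I hne _ _ (hR.trans hO.ge)
  refine hUI i (Function.update σ j τ) fun x hx => Finset.mem_biUnion.mpr ?_
  by_cases hxj : x ∈ shiftF (I j) τ
  · exact ⟨j, by simp [hij.symm], by simpa using hxj⟩
  · obtain ⟨k, hk, hxk⟩ := hσ x (Finset.mem_sdiff.mpr ⟨hx, hxj⟩)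
    rw [Finset.mem_erase] at hk
    exact ⟨k, hk.2, by rwa [Function.update_of_ne hk.1]⟩
end

section
/- Let M ≥ 3 and let (I_1, …, I_M) be a user-irrepressible family of subsets of Z_L, each of Hamming weight M+1. Then for every i ∈ {1,…,M}, all distinct j, k ∈ {1,…,M}\{i} with k ∈ B_i, every τ_k ∈ T_{i,k}, and every τ ∈ Z_L, one has |I_{i,k,τ_k} ∩ (I_j + τ)| ≤ 1. -/
/-- A set of at most `#S` points can be covered by suitable shifts of the nonempty sets `I l`,
`l ∈ S`. -/
theorem exists_subset_biUnion_shiftF {ι : Type*} [DecidableEq ι] {L : ℕ}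
    (I : ι → Finset (ZMod L)) (hI : ∀ l, (I l).Nonempty) (S : Finset ι) (R : Finset (ZMod L))
    (h : R.card ≤ S.card) :
    ∃ τ : ι → ZMod L, R ⊆ S.biUnion fun l => shiftF (I l) (τ l) := by
  choose a ha using hI
  obtain ⟨f⟩ : Nonempty (R ↪ S) := Function.Embedding.nonempty_of_card_le (by simpa using h)
  have hf : Function.Injective fun r => (f r : ι) := Subtype.val_injective.comp f.injective
  refine ⟨Function.extend (fun r => (f r : ι)) (fun r => (r : ZMod L) - a (f r)) 0,
    fun r hr => Finset.mem_biUnion.2 ⟨f ⟨r, hr⟩, (f ⟨r, hr⟩).2, ?_⟩⟩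
  rw [hf.extend_apply _ _ ⟨r, hr⟩]
  exact Finset.mem_image.2 ⟨a (f ⟨r, hr⟩), ha _, add_sub_cancel _ _⟩

theorem stmt4 {L M : ℕ} [NeZero L] (hM : 3 ≤ M) (I : Fin M → Finset (ZMod L))
    (hw : ∀ i, (I i).card = M + 1) (hUI : UI I) :
    ∀ i j k : Fin M, j ≠ i → k ≠ i → j ≠ k → k ∈ Bset I i →
      ∀ τk ∈ Tset (I i) (I k), ∀ τ : ZMod L,
        ((I i \ shiftF (I k) τk) ∩ shiftF (I j) τ).card ≤ 1 := by
  intro i j k hji hki hjk hk τk hτk τ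
  by_contra! hlt
  have hmax : Hmax (I i) (I j) ≤ Hmax (I i) (I k) :=
    (Finset.mem_filter.1 hk).2 j (by simp [hji])
  have hj : Hcc (I i) (I j) τ ≤ Hmax (I i) (I j) := Finset.le_sup (Finset.mem_univ τ)
  have hkk : Hcc (I i) (I k) τk = Hmax (I i) (I k) := (Finset.mem_filter.1 hτk).2
  have hle : ((I i \ shiftF (I k) τk) ∩ shiftF (I j) τ).card ≤ Hcc (I i) (I j) τ :=
    Finset.card_le_card (Finset.inter_subset_inter_right Finset.sdiff_subset)
  have hsplit : (I i ∩ shiftF (I k) τk).card + (I i \ shiftF (I k) τk).card = (I i).card :=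
    Finset.card_inter_add_card_sdiff _ _
  have hsplit' := Finset.card_inter_add_card_sdiff (I i \ shiftF (I k) τk) (shiftF (I j) τ)
  have hcard : (((Finset.univ.erase i).erase j).erase k).card = M - 3 := by
    rw [Finset.card_erase_of_mem (by simp [hki, hjk.symm]),
      Finset.card_erase_of_mem (by simp [hji]), Finset.card_erase_of_mem (by simp),
      Finset.card_fin]
    lia
  obtain ⟨σ, hσ⟩ := exists_subset_biUnion_shiftF I
    (fun l => Finset.card_pos.1 (by simp [hw l])) (((Finset.univ.erase i).erase j).erase k)
    ((I i \ shiftF (I k) τk) \ shiftF (I j) τ) (by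
      rw [hcard]
      unfold Hcc at hkk hj hle
      have := hw i
      lia)
  refine hUI i (Function.update (Function.update σ j τ) k τk) fun x hx => ?_
  rw [Finset.mem_biUnion]
  by_cases hxk : x ∈ shiftF (I k) τk
  · exact ⟨k, by simp [hki], by simpa using hxk⟩
  by_cases hxj : x ∈ shiftF (I j) τ
  · exact ⟨j, by simp [hji], by simpa [hjk] using hxj⟩
  obtain ⟨l, hl, hxl⟩ := Finset.mem_biUnion.1 (hσ (Finset.mem_sdiff.2 ⟨Finset.mem_sdiff.2 ⟨hx, hxk⟩, hxj⟩))
  simp only [Finset.mem_erase, Finset.mem_univ, and_true] at hl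
  exact ⟨l, by simp [hl.2.2], by simpa [hl.1, hl.2.1] using hxl⟩
end

section
/- Let I_1 and I_2 be equi-difference subsets of Z_L, both of the same Hamming weight w, with generators g_1 and g_2 respectively. If H_{I_1,I_2} ≤ 2, then |d*(I_1) ∩ d*(I_2)| ≤ 4. -/
/-- `S` is equi-difference of weight `w` with generator `g`:
`S = {0, g, 2g, …, (w-1)g}` and `|S| = w`. -/
def EquiDiff {L : ℕ} (S : Finset (ZMod L)) (w : ℕ) (g : ZMod L) : Prop :=
  S = (Finset.range w).image (fun t : ℕ => (t : ZMod L) * g) ∧ S.card = w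

/-- Every difference of an equi-difference set is attained from one of its two end points. -/
lemma EquiDiff.exists_endpoint {L w : ℕ} {S : Finset (ZMod L)} {g : ZMod L}
    (h : EquiDiff S w g) :
    ∃ e : ZMod L, ∀ x ∈ dstar S, (0 ∈ S ∧ e ∈ S) ∧ (x ∈ S ∨ e + x ∈ S) := by
  have hS : ∀ y, y ∈ S ↔ ∃ t : ℕ, t < w ∧ (t : ZMod L) * g = y := by
    intro y
    rw [h.1]
    simp
  refine ⟨((w - 1 : ℕ) : ZMod L) * g, fun x hx => ?_⟩
  simp only [dstar, Finset.mem_image, Finset.mem_filter, Finset.mem_product, Prod.exists] at hx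
  obtain ⟨a, b, ⟨⟨ha, hb⟩, -⟩, rfl⟩ := hx
  obtain ⟨s, hs, rfl⟩ := (hS a).1 ha
  obtain ⟨t, ht, rfl⟩ := (hS b).1 hb
  refine ⟨⟨(hS _).2 ⟨0, by omega, by simp⟩, (hS _).2 ⟨w - 1, by omega, rfl⟩⟩, ?_⟩
  rcases le_total t s with hts | hst
  · refine Or.inl ((hS _).2 ⟨s - t, by omega, ?_⟩)
    rw [Nat.cast_sub hts]
    ring
  · refine Or.inr ((hS _).2 ⟨w - 1 - (t - s), by omega, ?_⟩)
    rw [Nat.cast_sub (show t - s ≤ w - 1 by omega), Nat.cast_sub hst]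
    ring

/-- If two sets contain translates of the same three points `0, x, y`, then some Hamming
cross-correlation value is at least `3`. -/
lemma exists_three_le_Hcc {L : ℕ} {I₁ I₂ : Finset (ZMod L)} {a b x y : ZMod L}
    (hx : x ≠ 0) (hy : y ≠ 0) (hxy : x ≠ y)
    (ha : a ∈ I₁) (hax : a + x ∈ I₁) (hay : a + y ∈ I₁)
    (hb : b ∈ I₂) (hbx : b + x ∈ I₂) (hby : b + y ∈ I₂) :
    3 ≤ Hcc I₁ I₂ (a - b) := by
  have hcard : ({a, a + x, a + y} : Finset (ZMod L)).card = 3 :=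
    Finset.card_eq_three.2 ⟨a, a + x, a + y, by simpa using hx, by simpa using hy,
      by simpa using hxy, rfl⟩
  rw [← hcard]
  refine Finset.card_le_card fun z hz => ?_
  simp only [Finset.mem_insert, Finset.mem_singleton] at hz
  simp only [shiftF, Finset.mem_inter, Finset.mem_image]
  rcases hz with rfl | rfl | rfl
  · exact ⟨ha, b, hb, by ring⟩
  · exact ⟨hax, b + x, hbx, by ring⟩
  · exact ⟨hay, b + y, hby, by ring⟩

lemma ne_zero_of_mem_dstar {L : ℕ} {S : Finset (ZMod L)} {x : ZMod L} (hx : x ∈ dstar S) :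
    x ≠ 0 := by
  simp only [dstar, Finset.mem_image, Finset.mem_filter] at hx
  obtain ⟨p, ⟨-, hp⟩, rfl⟩ := hx
  exact sub_ne_zero.2 hp

theorem stmt6 {L w : ℕ} (I₁ I₂ : Finset (ZMod L)) (g₁ g₂ : ZMod L)
    (h₁ : EquiDiff I₁ w g₁) (h₂ : EquiDiff I₂ w g₂)
    (hH : ∀ τ : ZMod L, Hcc I₁ I₂ τ ≤ 2) :
    (dstar I₁ ∩ dstar I₂).card ≤ 4 := by
  obtain ⟨e₁, he₁⟩ := h₁.exists_endpoint
  obtain ⟨e₂, he₂⟩ := h₂.exists_endpoint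
  have common : ∀ (S : Finset (ZMod L)) (e x y : ZMod L), (0 ∈ S ∧ e ∈ S) →
      (x ∈ S ∨ e + x ∈ S) → (y ∈ S ∨ e + y ∈ S) → (x ∈ S ↔ y ∈ S) →
      ∃ a ∈ S, a + x ∈ S ∧ a + y ∈ S := by
    intro S e x y he hx hy hxy
    by_cases h : x ∈ S
    · exact ⟨0, he.1, by simpa using h, by simpa using hxy.1 h⟩
    · exact ⟨e, he.2, hx.resolve_left h, hy.resolve_left (mt hxy.2 h)⟩
  have hcard : (Finset.univ : Finset (Bool × Bool)).card = 4 := rfl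
  rw [← hcard]
  refine Finset.card_le_card_of_injOn (fun x => (decide (x ∈ I₁), decide (x ∈ I₂)))
    (fun _ _ => Finset.mem_coe.2 (Finset.mem_univ _)) fun x hx y hy hxy => ?_
  obtain ⟨hx₁, hx₂⟩ := Finset.mem_inter.1 (Finset.mem_coe.1 hx)
  obtain ⟨hy₁, hy₂⟩ := Finset.mem_inter.1 (Finset.mem_coe.1 hy)
  simp only [Prod.mk.injEq, decide_eq_decide] at hxy
  by_contra hne
  obtain ⟨a, ha, hax, hay⟩ := common I₁ e₁ x y (he₁ x hx₁).1 (he₁ x hx₁).2 (he₁ y hy₁).2 hxy.1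
  obtain ⟨b, hb, hbx, hby⟩ := common I₂ e₂ x y (he₂ x hx₂).1 (he₂ x hx₂).2 (he₂ y hy₂).2 hxy.2
  have h3 := exists_three_le_Hcc (ne_zero_of_mem_dstar hx₁) (ne_zero_of_mem_dstar hy₁) hne
    ha hax hay hb hbx hby
  exact absurd (hH (a - b)) (by omega)
end

section
/- Let M ≥ 4 be an integer, p the smallest prime with p > M, and let I_0, I_1, …, I_p ⊆ Z_{p(2M−1)} be the CRTm sequences. Then each I_j is an equi-difference subset of Z_{p(2M−1)} of Hamming weight M+1, and for every subset S ⊆ {0,1,…,p} with |S| = M, the family (I_j)_{j∈S} is user-irrepressible. -/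
/-- The CRTm sequences: for `j < p`, `I_j = f⁻¹({(j·y, y) : 0 ≤ y ≤ M})`, and
`I_p = f⁻¹({(y, 0) : 0 ≤ y ≤ M})`, where `f` is the Chinese-remainder ring
isomorphism `ZMod (p(2M-1)) ≃+* ZMod p × ZMod (2M-1)`. -/
def CRTmSeq (M p : ℕ) (h : Nat.Coprime p (2 * M - 1)) (j : ℕ) :
    Finset (ZMod (p * (2 * M - 1))) :=
  if j = p then
    (Finset.range (M + 1)).image fun y : ℕ =>
      (ZMod.chineseRemainder h).symm ((y : ZMod p), (0 : ZMod (2 * M - 1)))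
  else
    (Finset.range (M + 1)).image fun y : ℕ =>
      (ZMod.chineseRemainder h).symm (((j * y : ℕ) : ZMod p), ((y : ℕ) : ZMod (2 * M - 1)))

/-- The generator of the CRTm sequence with index `j`. -/
def crtmGen (M p : ℕ) (h : Nat.Coprime p (2 * M - 1)) (j : ℕ) : ZMod (p * (2 * M - 1)) :=
  (ZMod.chineseRemainder h).symm (if j = p then (1, 0) else ((j : ZMod p), 1))

theorem CRTmSeq_eq_image (M p : ℕ) (h : Nat.Coprime p (2 * M - 1)) (j : ℕ) :
    CRTmSeq M p h j = (Finset.range (M + 1)).image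
      (fun t : ℕ => (t : ZMod (p * (2 * M - 1))) * crtmGen M p h j) := by
  unfold CRTmSeq crtmGen
  split_ifs <;> refine Finset.image_congr fun y _ => ?_ <;>
    apply (ZMod.chineseRemainder h).injective <;>
    rw [map_mul, map_natCast, RingEquiv.apply_symm_apply, RingEquiv.apply_symm_apply] <;>
    ext <;> simp [mul_comm]

/-- If two generators agree after multiplication by `a` and `b`, then so do their residues. -/
theorem crtmGen_mul_eq {M p : ℕ} {h : Nat.Coprime p (2 * M - 1)} {i j : ℕ} {a b : ℤ}
    (hab : (a : ZMod (p * (2 * M - 1))) * crtmGen M p h i = b * crtmGen M p h j) :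
    (p : ℤ) ∣ a * (if i = p then 1 else (i : ℤ)) - b * (if j = p then 1 else (j : ℤ)) ∧
    ((2 * M - 1 : ℕ) : ℤ) ∣ a * (if i = p then 0 else 1) - b * (if j = p then 0 else 1) := by
  have key := congrArg (ZMod.chineseRemainder h) hab
  simp only [crtmGen, map_mul, map_intCast, RingEquiv.apply_symm_apply] at key
  have h1 := congrArg Prod.fst key
  have h2 := congrArg Prod.snd key
  constructor
  · rw [← ZMod.intCast_zmod_eq_zero_iff_dvd]
    push_cast
    split_ifs at h1 ⊢ <;> simpa using sub_eq_zero.mpr h1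
  · rw [← ZMod.intCast_zmod_eq_zero_iff_dvd]
    push_cast
    split_ifs at h2 ⊢ <;> simpa using sub_eq_zero.mpr h2

/-- Two distinct CRTm sequences share a difference `a` times the first generator, with
`1 ≤ a ≤ M`, only if `M - 1 ≤ a`; the case `a = M - 1` forces a congruence on the indices. -/
theorem crtmGen_common_difference {M p : ℕ} (hM : 4 ≤ M) (hp : p.Prime) (hpM : M < p)
    {h : Nat.Coprime p (2 * M - 1)} {i j : ℕ} (hi : i ≤ p) (hj : j ≤ p) (hij : i ≠ j) {a b : ℤ}
    (ha : 1 ≤ a) (haM : a ≤ M) (hb : -M ≤ b) (hbM : b ≤ M)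
    (hab : (a : ZMod (p * (2 * M - 1))) * crtmGen M p h i = b * crtmGen M p h j) :
    (M : ℤ) - 1 ≤ a ∧
      (a = M - 1 → i < p ∧ j < p ∧ (p : ℤ) ∣ ((M : ℤ) - 1) * i + M * j) := by
  obtain ⟨h1, h2⟩ := crtmGen_mul_eq hab
  have hL : ((2 * M - 1 : ℕ) : ℤ) = 2 * M - 1 := by omega
  rw [hL] at h2
  have hsmall : ∀ c : ℤ, (2 * M - 1 : ℤ) ∣ c → |c| < 2 * M - 1 → c = 0 :=
    fun c => Int.eq_zero_of_abs_lt_dvd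
  have hndvd : ¬ (p : ℤ) ∣ a := fun hd => by
    have := Int.le_of_dvd (by omega) hd
    omega
  by_cases hip : i = p
  · have hjp : j ≠ p := fun hjp => hij (hip.trans hjp.symm)
    simp only [hip, hjp, if_true, if_false, mul_zero, mul_one, zero_sub, dvd_neg] at h1 h2
    have hb0 := hsmall b h2 (by rw [abs_lt]; omega)
    rw [hb0, zero_mul, sub_zero] at h1
    exact absurd h1 hndvd
  by_cases hjp : j = p
  · simp only [hip, hjp, if_true, if_false, mul_zero, mul_one, sub_zero] at h2
    have := hsmall a h2 (by rw [abs_lt]; omega)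
    omega
  simp only [hip, hjp, if_false, mul_one] at h1 h2
  by_cases heq : a = b
  · rw [← heq, ← mul_sub] at h1
    rcases (Nat.prime_iff_prime_int.mp hp).dvd_or_dvd h1 with hd | hd
    · exact absurd hd hndvd
    · have := Int.eq_zero_of_abs_lt_dvd hd (by rw [abs_lt]; omega)
      omega
  have hdiff : a - b = 2 * M - 1 := by
    have h0 := hsmall (a - b - (2 * M - 1)) (dvd_sub_self_right.mpr h2)
    by_contra hne
    by_cases hlt : |a - b| < 2 * M - 1
    · have := hsmall _ h2 hlt
      omega
    · have : |a - b - (2 * M - 1)| < 2 * M - 1 := by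
        rw [abs_lt] at hlt ⊢
        omega
      have := h0 this
      omega
  refine ⟨by omega, fun haM' => ⟨by omega, by omega, ?_⟩⟩
  have hbM' : b = -M := by omega
  rwa [haM', hbM', neg_mul, sub_neg_eq_add] at h1

theorem crtm_index_unique {M p i j k : ℕ} (hM : 0 < M) (hp : p.Prime) (hpM : M < p)
    (hj : j < p) (hk : k < p) (hdj : (p : ℤ) ∣ ((M : ℤ) - 1) * i + M * j)
    (hdk : (p : ℤ) ∣ ((M : ℤ) - 1) * i + M * k) : j = k := by
  have hd : (p : ℤ) ∣ M * ((j : ℤ) - k) := by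
    have := dvd_sub hdj hdk
    rwa [add_sub_add_left_eq_sub, ← mul_sub] at this
  rcases (Nat.prime_iff_prime_int.mp hp).dvd_or_dvd hd with hd | hd
  · have := Int.le_of_dvd (by omega) hd
    omega
  · have := Int.eq_zero_of_abs_lt_dvd hd (by rw [abs_lt]; omega)
    omega

theorem crtmGen_mul_injOn {M p : ℕ} (hM : 4 ≤ M) (hpM : M < p)
    (h : Nat.Coprime p (2 * M - 1)) (j : ℕ) :
    Set.InjOn (fun t : ℕ => (t : ZMod (p * (2 * M - 1))) * crtmGen M p h j)
      (Finset.range (M + 1) : Set ℕ) := by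
  intro y hy z hz hyz
  simp only [Finset.coe_range, Set.mem_Iio] at hy hz
  have hyz' : (((y : ℤ) - z : ℤ) : ZMod (p * (2 * M - 1))) * crtmGen M p h j =
      ((0 : ℤ) : ZMod (p * (2 * M - 1))) * crtmGen M p h j := by
    push_cast
    rw [sub_mul, zero_mul, sub_eq_zero]
    exact hyz
  obtain ⟨h1, h2⟩ := crtmGen_mul_eq hyz'
  by_cases hjp : j = p
  · simp only [hjp, if_true, mul_one, sub_zero] at h1
    have := Int.eq_zero_of_abs_lt_dvd h1 (by rw [abs_lt]; omega)
    omega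
  · simp only [hjp, if_false, mul_one, sub_zero] at h2
    have := Int.eq_zero_of_abs_lt_dvd h2 (by rw [abs_lt]; omega)
    omega

theorem stmt8 (M p : ℕ) (hM : 4 ≤ M) (hp : p.Prime) (hpM : M < p)
    (hmin : ∀ q : ℕ, q.Prime → M < q → p ≤ q) (h : Nat.Coprime p (2 * M - 1)) :
    (∀ j ≤ p, ∃ g : ZMod (p * (2 * M - 1)), EquiDiff (CRTmSeq M p h j) (M + 1) g) ∧
    (∀ S : Finset ℕ, S ⊆ Finset.range (p + 1) → S.card = M →
      ∀ i ∈ S, ∀ τ : ℕ → ZMod (p * (2 * M - 1)),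
        ¬ CRTmSeq M p h i ⊆ (S.erase i).biUnion fun j => shiftF (CRTmSeq M p h j) (τ j)) := by
  refine ⟨fun j _ => ⟨crtmGen M p h j, CRTmSeq_eq_image M p h j, ?_⟩, ?_⟩
  · rw [CRTmSeq_eq_image, Finset.card_image_of_injOn (crtmGen_mul_injOn hM hpM h j),
      Finset.card_range]
  intro S hS hcard i hi τ hcover
  have hle : ∀ j ∈ S, j ≤ p := fun j hj => Nat.lt_succ_iff.mp (Finset.mem_range.mp (hS hj))
  have hcov : ∀ y : ℕ, ∃ j, y ≤ M → j ∈ S.erase i ∧ ∃ z ≤ M,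
      (z : ZMod (p * (2 * M - 1))) * crtmGen M p h j + τ j = y * crtmGen M p h i := by
    intro y
    by_cases hy : y ≤ M
    · have hmem : (y : ZMod (p * (2 * M - 1))) * crtmGen M p h i ∈ CRTmSeq M p h i := by
        rw [CRTmSeq_eq_image]
        exact Finset.mem_image_of_mem _ (Finset.mem_range.mpr (by omega))
      obtain ⟨j, hj, hyj⟩ := Finset.mem_biUnion.mp (hcover hmem)
      obtain ⟨x, hx, hxy⟩ := Finset.mem_image.mp hyj
      rw [CRTmSeq_eq_image] at hx
      obtain ⟨z, hz, rfl⟩ := Finset.mem_image.mp hx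
      exact ⟨j, fun _ => ⟨hj, z, Nat.lt_succ_iff.mp (Finset.mem_range.mp hz), hxy⟩⟩
    · exact ⟨0, fun hy' => absurd hy' hy⟩
  choose c hc using hcov
  have hpair : ∀ y y' : ℕ, y < y' → y' ≤ M → c y = c y' → M - 1 ≤ y' - y ∧
      (y' - y = M - 1 → c y < p ∧ (p : ℤ) ∣ ((M : ℤ) - 1) * i + M * c y) := by
    intro y y' hlt hy' heq
    obtain ⟨hcS, z, hz, hzy⟩ := hc y (by omega)
    obtain ⟨-, z', hz', hzy'⟩ := hc y' hy'
    rw [← heq] at hzy'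
    have hdiff : (((y' : ℤ) - y : ℤ) : ZMod (p * (2 * M - 1))) * crtmGen M p h i =
        (((z' : ℤ) - z : ℤ) : ZMod (p * (2 * M - 1))) * crtmGen M p h (c y) := by
      push_cast
      linear_combination hzy - hzy'
    obtain ⟨hne, hcS⟩ := Finset.mem_erase.mp hcS
    obtain ⟨h1, h2⟩ := crtmGen_common_difference hM hp hpM (hle i hi) (hle _ hcS) hne.symm
      (by omega) (by omega) (by omega) (by omega) hdiff
    exact ⟨by omega, fun hy => (h2 (by omega)).2⟩
  have hcardE : (S.erase i).card = M - 1 := by rw [Finset.card_erase_of_mem hi, hcard]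
  -- A block of `M` consecutive positions whose endpoints are covered by different sequences
  -- would need `M` covering sequences.
  have hblock : ∀ s ≤ 1, c s = c (s + (M - 1)) := by
    intro s hs
    by_contra hne
    have hmaps : ∀ y ∈ Finset.Ico s (s + M), c y ∈ S.erase i := fun y hy =>
      (hc y (by rw [Finset.mem_Ico] at hy; omega)).1
    obtain ⟨y, hy, y', hy', hyy', heq⟩ := Finset.exists_ne_map_eq_of_card_lt_of_maps_to
      (by rw [hcardE, Nat.card_Ico]; omega) hmaps
    rw [Finset.mem_Ico] at hy hy'
    wlog hlt : y < y' generalizing y y'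
    · exact this y' hy' y hy hyy'.symm heq.symm (by omega)
    have hfar := (hpair y y' hlt (by omega) heq).1
    obtain rfl : y = s := by omega
    obtain rfl : y' = y + (M - 1) := by omega
    exact hne heq
  obtain ⟨h0, hd0⟩ := (hpair 0 (0 + (M - 1)) (by omega) (by omega) (hblock 0 zero_le_one)).2
    (by omega)
  obtain ⟨h1, hd1⟩ := (hpair 1 (1 + (M - 1)) (by omega) (by omega) (hblock 1 le_rfl)).2 (by omega)
  have := (hpair 0 1 one_pos (by omega)
    (crtm_index_unique (by omega) hp hpM h0 h1 hd0 hd1)).1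
  omega
end

section
/- Let M ≥ 4 be an integer, p the smallest prime with p > M, and let I_0, …, I_p ⊆ Z_{p(2M−1)} be the CRTm sequences. Then for every j ∈ {0,1,…,p−1}, the maximum Hamming cross-correlation satisfies H_{I_p,I_j} = 1; equivalently, d*(I_p) ∩ d*(I_j) = ∅. -/
theorem mem_dstar {L : ℕ} {S : Finset (ZMod L)} {d : ZMod L} :
    d ∈ dstar S ↔ ∃ a ∈ S, ∃ b ∈ S, a ≠ b ∧ a - b = d := by
  simp only [dstar, Finset.mem_image, Finset.mem_filter, Finset.mem_product, Prod.exists]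
  constructor
  · rintro ⟨a, b, ⟨⟨ha, hb⟩, hab⟩, hd⟩
    exact ⟨a, ha, b, hb, hab, hd⟩
  · rintro ⟨a, ha, b, hb, hab, hd⟩
    exact ⟨a, b, ⟨⟨ha, hb⟩, hab⟩, hd⟩

theorem Hcc_le_one_of_dstar_inter_eq_empty {L : ℕ} {A B : Finset (ZMod L)}
    (hAB : dstar A ∩ dstar B = ∅) (τ : ZMod L) : Hcc A B τ ≤ 1 := by
  refine Finset.card_le_one.2 fun x hx y hy => ?_
  simp only [shiftF, Finset.mem_inter, Finset.mem_image] at hx hy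
  obtain ⟨hxA, b, hb, rfl⟩ := hx
  obtain ⟨hyA, c, hc, rfl⟩ := hy
  by_contra hne
  have hmem : b - c ∈ dstar A ∩ dstar B := Finset.mem_inter.2
    ⟨mem_dstar.2 ⟨_, hxA, _, hyA, hne, add_sub_add_right_eq_sub b c τ⟩,
      mem_dstar.2 ⟨b, hb, c, hc, fun hbc => hne (by rw [hbc]), rfl⟩⟩
  simp [hAB] at hmem

theorem one_le_Hcc_zero {L : ℕ} {A B : Finset (ZMod L)} {x : ZMod L}
    (hA : x ∈ A) (hB : x ∈ B) : 1 ≤ Hcc A B 0 :=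
  Finset.card_pos.2 ⟨x, by simp [shiftF, hA, hB]⟩

section CRTm

variable {M p : ℕ} {h : Nat.Coprime p (2 * M - 1)}

theorem zero_mem_CRTmSeq (j : ℕ) : 0 ∈ CRTmSeq M p h j := by
  unfold CRTmSeq
  split_ifs <;> refine Finset.mem_image.2 ⟨0, by simp, ?_⟩ <;>
    simp [← Prod.zero_eq_mk]

theorem snd_eq_zero_of_mem_CRTmSeq_self {x : ZMod (p * (2 * M - 1))}
    (hx : x ∈ CRTmSeq M p h p) : (ZMod.chineseRemainder h x).2 = 0 := by
  rw [CRTmSeq, if_pos rfl] at hx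
  obtain ⟨y, -, rfl⟩ := Finset.mem_image.1 hx
  simp

theorem eq_of_mem_CRTmSeq_of_snd_eq (hM : 3 ≤ M) {j : ℕ} (hj : j ≠ p)
    {a b : ZMod (p * (2 * M - 1))} (ha : a ∈ CRTmSeq M p h j) (hb : b ∈ CRTmSeq M p h j)
    (hab : (ZMod.chineseRemainder h a).2 = (ZMod.chineseRemainder h b).2) : a = b := by
  rw [CRTmSeq, if_neg hj] at ha hb
  obtain ⟨y, hy, rfl⟩ := Finset.mem_image.1 ha
  obtain ⟨z, hz, rfl⟩ := Finset.mem_image.1 hb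
  rw [Finset.mem_range] at hy hz
  simp only [RingEquiv.apply_symm_apply] at hab
  rw [ZMod.natCast_eq_natCast_iff] at hab
  rw [hab.eq_of_lt_of_lt (by omega) (by omega)]

theorem dstar_CRTmSeq_inter_eq_empty (hM : 3 ≤ M) {j : ℕ} (hj : j ≠ p) :
    dstar (CRTmSeq M p h p) ∩ dstar (CRTmSeq M p h j) = ∅ := by
  refine Finset.eq_empty_of_forall_notMem fun d hd => ?_
  obtain ⟨hdp, hdj⟩ := Finset.mem_inter.1 hd
  obtain ⟨a, ha, b, hb, -, rfl⟩ := mem_dstar.1 hdp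
  obtain ⟨c, hc, e, he, hne, hd⟩ := mem_dstar.1 hdj
  refine hne (eq_of_mem_CRTmSeq_of_snd_eq hM hj hc he (sub_eq_zero.1 ?_))
  rw [← Prod.snd_sub, ← map_sub, hd, map_sub, Prod.snd_sub,
    snd_eq_zero_of_mem_CRTmSeq_self ha, snd_eq_zero_of_mem_CRTmSeq_self hb, sub_zero]

end CRTm

theorem stmt9 (M p : ℕ) (hM : 4 ≤ M) (hp : p.Prime) (hpM : M < p)
    (hmin : ∀ q : ℕ, q.Prime → M < q → p ≤ q) (h : Nat.Coprime p (2 * M - 1)) :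
    ∀ j < p,
      (∀ τ : ZMod (p * (2 * M - 1)), Hcc (CRTmSeq M p h p) (CRTmSeq M p h j) τ ≤ 1) ∧
      (∃ τ : ZMod (p * (2 * M - 1)), Hcc (CRTmSeq M p h p) (CRTmSeq M p h j) τ = 1) ∧
      dstar (CRTmSeq M p h p) ∩ dstar (CRTmSeq M p h j) = ∅ := by
  intro j hj
  have hempty := dstar_CRTmSeq_inter_eq_empty (h := h) (by omega : 3 ≤ M) hj.ne
  have hle := Hcc_le_one_of_dstar_inter_eq_empty hempty
  exact ⟨hle, ⟨0, (hle 0).antisymm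
    (one_le_Hcc_zero (zero_mem_CRTmSeq p) (zero_mem_CRTmSeq j))⟩, hempty⟩
end

section
/- Let M ≥ 4 be an integer, p the smallest prime with p > M, and let I_0, …, I_p ⊆ Z_{p(2M−1)} be the CRTm sequences. Then for all distinct i, j ∈ {0,1,…,p} and every τ ∈ Z_{p(2M−1)}, one has |I_i ∩ (I_j + τ)| ≤ 2. -/
theorem ZMod.natCast_injOn_lt {n a b : ℕ} (ha : a < n) (hb : b < n)
    (hab : (a : ZMod n) = b) : a = b := by
  rw [ZMod.natCast_eq_natCast_iff] at hab
  exact Nat.ModEq.eq_of_lt_of_lt hab ha hb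

theorem mem_CRTmSeq_self {M p : ℕ} {h : Nat.Coprime p (2 * M - 1)}
    {x : ZMod (p * (2 * M - 1))} :
    x ∈ CRTmSeq M p h p ↔ ∃ y ≤ M, ZMod.chineseRemainder h x = ((y : ZMod p), 0) := by
  simp [CRTmSeq, RingEquiv.symm_apply_eq,
    eq_comm (a := ZMod.chineseRemainder h x)]

theorem mem_CRTmSeq_of_ne {M p j : ℕ} {h : Nat.Coprime p (2 * M - 1)} (hj : j ≠ p)
    {x : ZMod (p * (2 * M - 1))} :
    x ∈ CRTmSeq M p h j ↔ ∃ y ≤ M, ZMod.chineseRemainder h x =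
      ((j * y : ZMod p), (y : ZMod (2 * M - 1))) := by
  simp [CRTmSeq, hj, RingEquiv.symm_apply_eq,
    eq_comm (a := ZMod.chineseRemainder h x)]

theorem mem_inter_shiftF {L : ℕ} {S T : Finset (ZMod L)} {τ x : ZMod L} :
    x ∈ S ∩ shiftF T τ ↔ x ∈ S ∧ ∃ z ∈ T, z + τ = x := by
  simp only [shiftF, Finset.mem_inter, Finset.mem_image]

/-- Among three integers in `[-m, m]` congruent modulo `2m - 1`, two coincide. -/
theorem eq_or_eq_or_eq_of_dvd_sub {m a b c : ℤ} (hm : 1 < m)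
    (ha : |a| ≤ m) (hb : |b| ≤ m) (hc : |c| ≤ m)
    (hab : 2 * m - 1 ∣ a - b) (hac : 2 * m - 1 ∣ a - c) (hbc : 2 * m - 1 ∣ b - c) :
    a = b ∨ a = c ∨ b = c := by
  have key : ∀ d : ℤ, 2 * m - 1 ∣ d → d = 0 ∨ 2 * m - 1 ≤ |d| := fun d hd =>
    (eq_or_ne d 0).imp_right fun h0 => Int.le_of_dvd (abs_pos.2 h0) ((dvd_abs _ _).2 hd)
  have h₁ := key _ hab
  have h₂ := key _ hac
  have h₃ := key _ hbc
  grind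

theorem card_inter_shiftF_self_left_le_one {M p j : ℕ} (hM : 2 ≤ M)
    (h : Nat.Coprime p (2 * M - 1)) (hj : j ≠ p) (τ : ZMod (p * (2 * M - 1))) :
    (CRTmSeq M p h p ∩ shiftF (CRTmSeq M p h j) τ).card ≤ 1 := by
  refine Finset.card_le_one.2 fun a ha b hb => ?_
  simp only [mem_inter_shiftF, mem_CRTmSeq_self, mem_CRTmSeq_of_ne hj] at ha hb
  obtain ⟨⟨y, -, hy⟩, u, ⟨z, hz, hu⟩, rfl⟩ := ha
  obtain ⟨⟨y', -, hy'⟩, u', ⟨z', hz', hu'⟩, rfl⟩ := hb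
  rw [map_add, hu] at hy
  rw [map_add, hu'] at hy'
  have e := congrArg Prod.snd hy
  have e' := congrArg Prod.snd hy'
  simp only [Prod.snd_add] at e e'
  obtain rfl : z = z' := ZMod.natCast_injOn_lt (n := 2 * M - 1) (by omega) (by omega)
    (add_right_cancel (e.trans e'.symm))
  rw [(ZMod.chineseRemainder h).injective (hu.trans hu'.symm)]

theorem card_inter_shiftF_self_right_le_one {M p i : ℕ} (hM : 2 ≤ M)
    (h : Nat.Coprime p (2 * M - 1)) (hi : i ≠ p) (τ : ZMod (p * (2 * M - 1))) :
    (CRTmSeq M p h i ∩ shiftF (CRTmSeq M p h p) τ).card ≤ 1 := by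
  refine Finset.card_le_one.2 fun a ha b hb => ?_
  simp only [mem_inter_shiftF, mem_CRTmSeq_self, mem_CRTmSeq_of_ne hi] at ha hb
  obtain ⟨⟨y, hyM, hy⟩, u, ⟨z, -, hu⟩, hua⟩ := ha
  obtain ⟨⟨y', hyM', hy'⟩, u', ⟨z', -, hu'⟩, hub⟩ := hb
  have e := congrArg Prod.snd hy
  have e' := congrArg Prod.snd hy'
  rw [← hua, map_add, hu] at e
  rw [← hub, map_add, hu'] at e'
  simp only [Prod.snd_add] at e e'
  obtain rfl : y = y' := ZMod.natCast_injOn_lt (n := 2 * M - 1) (by omega) (by omega)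
    (e.symm.trans e')
  exact (ZMod.chineseRemainder h).injective (hy.trans hy'.symm)

/-- A common element of `I_i` and `I_j + τ` (with `i, j ≠ p`) in coordinates. -/
theorem exists_of_mem_inter_shiftF {M p i j : ℕ} {h : Nat.Coprime p (2 * M - 1)}
    (hi : i ≠ p) (hj : j ≠ p) {τ x : ZMod (p * (2 * M - 1))}
    (hx : x ∈ CRTmSeq M p h i ∩ shiftF (CRTmSeq M p h j) τ) :
    ∃ y ≤ M, ∃ z ≤ M,
      ZMod.chineseRemainder h x = ((i * y : ZMod p), (y : ZMod (2 * M - 1))) ∧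
      (i * y - j * z : ZMod p) = (ZMod.chineseRemainder h τ).1 ∧
      (y - z : ZMod (2 * M - 1)) = (ZMod.chineseRemainder h τ).2 := by
  simp only [mem_inter_shiftF, mem_CRTmSeq_of_ne hi, mem_CRTmSeq_of_ne hj] at hx
  obtain ⟨⟨y, hyM, hy⟩, u, ⟨z, hzM, hu⟩, rfl⟩ := hx
  refine ⟨y, hyM, z, hzM, hy, ?_⟩
  rw [map_add, hu] at hy
  have e := congrArg Prod.fst hy
  have e' := congrArg Prod.snd hy
  simp only [Prod.fst_add, Prod.snd_add] at e e'
  exact ⟨by rw [← e]; ring, by rw [← e']; ring⟩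

theorem card_inter_shiftF_le_two {M p i j : ℕ} (hM : 2 ≤ M) (hp : p.Prime) (hpM : M < p)
    (h : Nat.Coprime p (2 * M - 1)) (hi : i < p) (hj : j < p) (hij : i ≠ j)
    (τ : ZMod (p * (2 * M - 1))) :
    (CRTmSeq M p h i ∩ shiftF (CRTmSeq M p h j) τ).card ≤ 2 := by
  have : Fact p.Prime := ⟨hp⟩
  by_contra! hlt
  obtain ⟨a, b, c, ha, hb, hc, hab, hac, hbc⟩ := Finset.two_lt_card_iff.1 hlt
  obtain ⟨y₁, hy₁, z₁, hz₁, hx₁, hτ₁, hd₁⟩ := exists_of_mem_inter_shiftF hi.ne hj.ne ha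
  obtain ⟨y₂, hy₂, z₂, hz₂, hx₂, hτ₂, hd₂⟩ := exists_of_mem_inter_shiftF hi.ne hj.ne hb
  obtain ⟨y₃, hy₃, z₃, hz₃, hx₃, hτ₃, hd₃⟩ := exists_of_mem_inter_shiftF hi.ne hj.ne hc
  have hdvd : ∀ {y z y' z' : ℕ}, (y - z : ZMod (2 * M - 1)) = y' - z' →
      2 * (M : ℤ) - 1 ∣ ((y : ℤ) - z) - (y' - z') := fun {y z y' z'} e => by
    have hcast : ((2 * M - 1 : ℕ) : ℤ) = 2 * (M : ℤ) - 1 := by omega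
    rw [← hcast, ← ZMod.intCast_zmod_eq_zero_iff_dvd]
    push_cast
    rw [e, sub_self]
  have huniq : ∀ {x x' : ZMod (p * (2 * M - 1))} {y z y' z' : ℕ}, y ≤ M → y' ≤ M →
      ZMod.chineseRemainder h x = ((i * y : ZMod p), (y : ZMod (2 * M - 1))) →
      ZMod.chineseRemainder h x' = ((i * y' : ZMod p), (y' : ZMod (2 * M - 1))) →
      (i * y - j * z : ZMod p) = i * y' - j * z' →
      (y : ℤ) - z = y' - z' → x = x' := by
    intro x x' y z y' z' hy hy' hx hx' e hd
    have hd' : (y - z : ZMod p) = y' - z' := by exact_mod_cast congrArg (Int.cast (R := ZMod p)) hd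
    have hmul : (i - j : ZMod p) * (y - y') = 0 := by linear_combination e - j * hd'
    obtain h0 | h0 := mul_eq_zero.1 hmul
    · exact absurd (ZMod.natCast_injOn_lt hi hj (sub_eq_zero.1 h0)) hij
    · obtain rfl := ZMod.natCast_injOn_lt (hy.trans_lt hpM) (hy'.trans_lt hpM) (sub_eq_zero.1 h0)
      exact (ZMod.chineseRemainder h).injective (hx.trans hx'.symm)
  have habs : ∀ {y z : ℕ}, y ≤ M → z ≤ M → |(y : ℤ) - z| ≤ M := fun hy hz => by
    rw [abs_le]; omega
  rcases eq_or_eq_or_eq_of_dvd_sub (by exact_mod_cast hM) (habs hy₁ hz₁) (habs hy₂ hz₂)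
    (habs hy₃ hz₃) (hdvd (hd₁.trans hd₂.symm)) (hdvd (hd₁.trans hd₃.symm))
    (hdvd (hd₂.trans hd₃.symm)) with e | e | e
  · exact hab (huniq hy₁ hy₂ hx₁ hx₂ (hτ₁.trans hτ₂.symm) e)
  · exact hac (huniq hy₁ hy₃ hx₁ hx₃ (hτ₁.trans hτ₃.symm) e)
  · exact hbc (huniq hy₂ hy₃ hx₂ hx₃ (hτ₂.trans hτ₃.symm) e)

theorem stmt10 (M p : ℕ) (hM : 4 ≤ M) (hp : p.Prime) (hpM : M < p)
    (hmin : ∀ q : ℕ, q.Prime → M < q → p ≤ q) (h : Nat.Coprime p (2 * M - 1)) :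
    ∀ i ≤ p, ∀ j ≤ p, i ≠ j → ∀ τ : ZMod (p * (2 * M - 1)),
      (CRTmSeq M p h i ∩ shiftF (CRTmSeq M p h j) τ).card ≤ 2 := by
  intro i hi j hj hij τ
  obtain rfl | hip := eq_or_ne i p
  · exact (card_inter_shiftF_self_left_le_one (by omega) h hij.symm τ).trans one_le_two
  obtain rfl | hjp := eq_or_ne j p
  · exact (card_inter_shiftF_self_right_le_one (by omega) h hip τ).trans one_le_two
  exact card_inter_shiftF_le_two (by omega) hp hpM h (hi.lt_of_ne hip) (hj.lt_of_ne hjp) hij τ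
end

section
/- Let M ≥ 4 be an integer and p a prime with p > M. Let i, j ∈ {0,1,…,p−1} with i ≠ j, and let y_1, y_1', y_2, y_2' ∈ {0,1,…,M} with y_1 ≠ y_1' and y_2 ≠ y_2'. If i·(y_1−y_1') ≡ j·(y_2−y_2') (mod p) and y_1−y_1' ≡ y_2−y_2' (mod 2M−1), then one of the following holds: (1) (y_1,y_1') = (M,0) and (y_2,y_2') ∈ {(0,M−1),(1,M)}; (2) (y_1,y_1') = (0,M) and (y_2,y_2') ∈ {(M−1,0),(M,1)}; (3) (y_1,y_1') ∈ {(0,M−1),(1,M)} and (y_2,y_2') = (M,0); (4) (y_1,y_1') ∈ {(M−1,0),(M,1)} and (y_2,y_2') = (0,M). -/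
/-- If two differences of integers in `[0, M]` are `2 * M - 1` apart, then the four integers are
extreme up to a single unit. -/
theorem extreme_of_sub_sub_eq {M a b c d : ℤ} (ha : a ≤ M) (hb : 0 ≤ b) (hc : 0 ≤ c)
    (hd : d ≤ M) (h : (a - b) - (c - d) = 2 * M - 1) :
    (a = M ∧ b = 0 ∧ ((c = 0 ∧ d = M - 1) ∨ (c = 1 ∧ d = M))) ∨
    (((a = M - 1 ∧ b = 0) ∨ (a = M ∧ b = 1)) ∧ c = 0 ∧ d = M) := by
  have hab : a - b = M ∨ a - b = M - 1 := by omega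
  rcases hab with hab | hab
  · exact Or.inl ⟨by omega, by omega, by omega⟩
  · exact Or.inr ⟨by omega, by omega, by omega⟩

theorem stmt11 (M p i j y₁ y₁' y₂ y₂' : ℤ) (hM : 4 ≤ M)
    (hp : Prime p) (hpM : M < p)
    (hi : 0 ≤ i) (hi' : i ≤ p - 1) (hj : 0 ≤ j) (hj' : j ≤ p - 1) (hij : i ≠ j)
    (hy₁ : 0 ≤ y₁) (hy₁M : y₁ ≤ M) (hy₁'0 : 0 ≤ y₁') (hy₁'M : y₁' ≤ M)
    (hy₂ : 0 ≤ y₂) (hy₂M : y₂ ≤ M) (hy₂'0 : 0 ≤ y₂') (hy₂'M : y₂' ≤ M)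
    (hne₁ : y₁ ≠ y₁') (hne₂ : y₂ ≠ y₂')
    (hcong₁ : i * (y₁ - y₁') ≡ j * (y₂ - y₂') [ZMOD p])
    (hcong₂ : y₁ - y₁' ≡ y₂ - y₂' [ZMOD 2 * M - 1]) :
    (y₁ = M ∧ y₁' = 0 ∧ ((y₂ = 0 ∧ y₂' = M - 1) ∨ (y₂ = 1 ∧ y₂' = M))) ∨
    (y₁ = 0 ∧ y₁' = M ∧ ((y₂ = M - 1 ∧ y₂' = 0) ∨ (y₂ = M ∧ y₂' = 1))) ∨
    (((y₁ = 0 ∧ y₁' = M - 1) ∨ (y₁ = 1 ∧ y₁' = M)) ∧ y₂ = M ∧ y₂' = 0) ∨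
    (((y₁ = M - 1 ∧ y₁' = 0) ∨ (y₁ = M ∧ y₁' = 1)) ∧ y₂ = 0 ∧ y₂' = M) := by
  have hd : y₁ - y₁' ≠ y₂ - y₂' := by
    intro h
    rw [← h] at hcong₁
    have hdvd : p ∣ (j - i) * (y₁ - y₁') := by
      rw [sub_mul]
      exact hcong₁.dvd
    rcases hp.dvd_or_dvd hdvd with h' | h'
    · have := Int.eq_zero_of_abs_lt_dvd h' (by rw [abs_lt]; omega)
      omega
    · have := Int.eq_zero_of_abs_lt_dvd h' (by rw [abs_lt]; omega)
      omega
  obtain ⟨k, hk⟩ := hcong₂.dvd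
  have hk_lt : k < 2 := by nlinarith
  have hk_gt : -2 < k := by nlinarith
  interval_cases k
  · have hdiff : (y₁ - y₁') - (y₂ - y₂') = 2 * M - 1 := by linarith
    rcases extreme_of_sub_sub_eq hy₁M hy₁'0 hy₂ hy₂'M hdiff with ⟨h₁, h₁', h⟩ | ⟨h, h₂, h₂'⟩
    · exact Or.inl ⟨h₁, h₁', h⟩
    · exact Or.inr (Or.inr (Or.inr ⟨h, h₂, h₂'⟩))
  · exact absurd (by linarith) hd
  · have hdiff : (y₁' - y₁) - (y₂' - y₂) = 2 * M - 1 := by linarith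
    rcases extreme_of_sub_sub_eq hy₁'M hy₁ hy₂'0 hy₂M hdiff with ⟨h₁', h₁, h⟩ | ⟨h, h₂', h₂⟩
    · exact Or.inr (Or.inl ⟨h₁, h₁', by simpa only [and_comm] using h⟩)
    · exact Or.inr (Or.inr (Or.inl ⟨by simpa only [and_comm] using h, h₂, h₂'⟩))
end

section
/- For every real ε > 0 there exists an integer M_0 such that for all integers M ≥ M_0 and all positive integers L: if (I_1, …, I_M) is a user-irrepressible family of subsets of Z_L in which every I_i is equi-difference of Hamming weight M+1, then L ≥ (1−ε)·2M². -/
/-- The set of multiples `a * g` with `a` an integer, `|a| ≤ m`. -/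
noncomputable def symmProg {L : ℕ} (g : ZMod L) (m : ℕ) : Finset (ZMod L) :=
  (Finset.Icc (-(m : ℤ)) m).image fun a : ℤ => (a : ZMod L) * g

lemma mem_symmProg {L : ℕ} {g x : ZMod L} {m : ℕ} :
    x ∈ symmProg g m ↔ ∃ a : ℤ, (-(m : ℤ) ≤ a ∧ a ≤ m) ∧ (a : ZMod L) * g = x := by
  simp [symmProg]

lemma mem_shiftF {L : ℕ} {S : Finset (ZMod L)} {τ x : ZMod L} :
    x ∈ shiftF S τ ↔ x - τ ∈ S := by
  simp only [shiftF, Finset.mem_image]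
  constructor
  · rintro ⟨y, hy, rfl⟩
    simpa using hy
  · intro h
    exact ⟨_, h, by ring⟩

lemma card_shiftF_inter_shiftF {L : ℕ} (A B : Finset (ZMod L)) (s t : ZMod L) :
    (shiftF A s ∩ shiftF B t).card = (A ∩ shiftF B (t - s)).card := by
  have h : shiftF A s ∩ shiftF B t = shiftF (A ∩ shiftF B (t - s)) s := by
    ext x
    simp only [Finset.mem_inter, mem_shiftF]
    rw [show x - s - (t - s) = x - t by ring]
  rw [h, shiftF, Finset.card_image_of_injective _ (add_left_injective s)]

namespace EquiDiff

variable {L m : ℕ} {S : Finset (ZMod L)} {g : ZMod L}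

lemma mem_iff (h : EquiDiff S (m + 1) g) {x : ZMod L} :
    x ∈ S ↔ ∃ t : ℕ, t ≤ m ∧ (t : ZMod L) * g = x := by
  rw [h.1]
  simp

lemma natCast_mul_inj (h : EquiDiff S (m + 1) g) {a b : ℕ} (ha : a ≤ m) (hb : b ≤ m)
    (hab : (a : ZMod L) * g = b * g) : a = b := by
  have hinj : Set.InjOn (fun t : ℕ => (t : ZMod L) * g) (Finset.range (m + 1)) := by
    rw [← Finset.card_image_iff, ← h.1, h.2, Finset.card_range]
  exact hinj (by simpa using Nat.lt_succ_of_le ha) (by simpa using Nat.lt_succ_of_le hb) hab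

lemma nonempty (h : EquiDiff S (m + 1) g) : S.Nonempty :=
  ⟨0, h.mem_iff.2 ⟨0, by simp, by simp⟩⟩

lemma symmProg_subset (h : EquiDiff S (m + 1) g) :
    symmProg g m ⊆ shiftF S 0 ∪ shiftF S (-(m * g)) := by
  intro x hx
  obtain ⟨a, ⟨h1, h2⟩, rfl⟩ := mem_symmProg.1 hx
  rw [Finset.mem_union, mem_shiftF, mem_shiftF, h.mem_iff, h.mem_iff]
  rcases le_total 0 a with ha | ha
  · lift a to ℕ using ha
    exact Or.inl ⟨a, by exact_mod_cast h2, by simp⟩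
  · obtain ⟨b, hb⟩ := Int.eq_ofNat_of_zero_le (show 0 ≤ a + m by omega)
    refine Or.inr ⟨b, by omega, ?_⟩
    have : (b : ZMod L) = ((a + m : ℤ) : ZMod L) := by rw [hb]; simp
    rw [this]
    push_cast
    ring

/-- Every pair of elements of `ZMod L` differing by an element of `symmProg g m` lies in a
shift of `S`. -/
lemma exists_shift (h : EquiDiff S (m + 1) g) {d : ZMod L} (hd : d ∈ symmProg g m)
    (x : ZMod L) : ∃ τ, x ∈ shiftF S τ ∧ x + d ∈ shiftF S τ := by
  obtain ⟨a, ⟨h1, h2⟩, rfl⟩ := mem_symmProg.1 hd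
  simp only [mem_shiftF, h.mem_iff]
  rcases le_total 0 a with ha | ha
  · lift a to ℕ using ha
    exact ⟨x, ⟨0, by simp, by simp⟩, ⟨a, by exact_mod_cast h2, by simp⟩⟩
  · obtain ⟨b, hb⟩ := Int.eq_ofNat_of_zero_le (show 0 ≤ -a by omega)
    obtain rfl : a = -(b : ℤ) := by omega
    exact ⟨x + ((-(b : ℤ) : ℤ) : ZMod L) * g, ⟨b, by omega, by push_cast; ring⟩,
      ⟨0, by simp, by simp⟩⟩

lemma lt_addOrderOf [NeZero L] (h : EquiDiff S (m + 1) g) : m < addOrderOf g := by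
  by_contra! hle
  have h0 := h.natCast_mul_inj hle (Nat.zero_le m)
    (by rw [← nsmul_eq_mul, addOrderOf_nsmul_eq_zero]; simp)
  exact (addOrderOf_pos g).ne' h0

end EquiDiff

lemma symmProg_mono {L : ℕ} (g : ZMod L) {m n : ℕ} (h : m ≤ n) :
    symmProg g m ⊆ symmProg g n := by
  intro x hx
  obtain ⟨a, ha, rfl⟩ := mem_symmProg.1 hx
  exact mem_symmProg.2 ⟨a, by omega, rfl⟩

lemma neg_mem_symmProg {L : ℕ} {g x : ZMod L} {m : ℕ} (h : x ∈ symmProg g m) :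
    -x ∈ symmProg g m := by
  obtain ⟨a, ha, rfl⟩ := mem_symmProg.1 h
  exact mem_symmProg.2 ⟨-a, by omega, by push_cast; ring⟩

lemma card_symmProg {L : ℕ} {g : ZMod L} {m : ℕ} (h : 2 * m < addOrderOf g) :
    (symmProg g m).card = 2 * m + 1 := by
  rw [symmProg, Finset.card_image_of_injOn, Int.card_Icc]
  · omega
  · intro a ha b hb hab
    simp only [Finset.coe_Icc, Set.mem_Icc] at ha hb
    have h0 : (a - b) • g = 0 := by
      rw [zsmul_eq_mul]
      push_cast
      rw [sub_mul]
      exact sub_eq_zero.2 hab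
    have hdvd := addOrderOf_dvd_iff_zsmul_eq_zero.2 h0
    have := Int.eq_zero_of_abs_lt_dvd hdvd (by rw [abs_lt]; omega)
    omega

lemma mem_symmProg_of_mem_zmultiples {L : ℕ} [NeZero L] {g x : ZMod L} {m : ℕ}
    (h : addOrderOf g ≤ 2 * m) (hx : x ∈ AddSubgroup.zmultiples g) : x ∈ symmProg g m := by
  obtain ⟨z, rfl⟩ := AddSubgroup.mem_zmultiples_iff.1 hx
  have hpos : (0 : ℤ) < addOrderOf g := by exact_mod_cast addOrderOf_pos g
  have h1 := Int.emod_nonneg (z + m) hpos.ne'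
  have h2 := Int.emod_lt_of_pos (z + m) hpos
  refine mem_symmProg.2 ⟨(z + m) % addOrderOf g - m, by omega, ?_⟩
  rw [← zsmul_eq_mul, sub_smul, mod_addOrderOf_zsmul, add_smul, add_sub_cancel_right]

lemma ZMod.mem_zmultiples_of_nsmul_eq_zero {L : ℕ} [NeZero L] {g x : ZMod L}
    (h : addOrderOf g • x = 0) : x ∈ AddSubgroup.zmultiples g := by
  classical
  have hle := IsAddCyclic.card_nsmul_eq_zero_le (α := ZMod L) (addOrderOf_pos g)
  have hsub : (AddSubgroup.zmultiples g : Set (ZMod L)).toFinset ⊆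
      Finset.univ.filter fun a : ZMod L => addOrderOf g • a = 0 := by
    intro y hy
    simp only [Set.mem_toFinset, SetLike.mem_coe] at hy
    obtain ⟨z, rfl⟩ := AddSubgroup.mem_zmultiples_iff.1 hy
    rw [Finset.mem_filter, smul_comm, addOrderOf_nsmul_eq_zero, smul_zero]
    exact ⟨Finset.mem_univ _, rfl⟩
  have hcard : (AddSubgroup.zmultiples g : Set (ZMod L)).toFinset.card = addOrderOf g := by
    rw [Set.toFinset_card, ← Nat.card_eq_fintype_card]
    exact Nat.card_zmultiples g
  have heq := Finset.eq_of_subset_of_card_le hsub (by rw [hcard]; exact hle)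
  have hx : x ∈ (AddSubgroup.zmultiples g : Set (ZMod L)).toFinset := by
    rw [heq]
    simpa using h
  simpa using hx

lemma gcd_addOrderOf_le_card_inter {L : ℕ} [NeZero L] {g h : ZMod L} {m : ℕ}
    (hg : addOrderOf g ≤ 2 * m) (hh : addOrderOf h ≤ 2 * m) :
    (addOrderOf g).gcd (addOrderOf h) ≤ (symmProg g m ∩ symmProg h m).card := by
  classical
  set d := (addOrderOf g).gcd (addOrderOf h) with hd
  obtain ⟨e, he⟩ : d ∣ addOrderOf g := Nat.gcd_dvd_left _ _
  have hepos : e ≠ 0 := by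
    rintro rfl
    exact (addOrderOf_pos g).ne' he
  have hord : addOrderOf (e • g) = d := by
    rw [addOrderOf_nsmul_of_dvd hepos (by rw [he]; exact dvd_mul_left e d), he,
      Nat.mul_div_cancel _ (Nat.pos_of_ne_zero hepos)]
  have hcard : (AddSubgroup.zmultiples (e • g) : Set (ZMod L)).toFinset.card = d := by
    rw [Set.toFinset_card, ← Nat.card_eq_fintype_card, ← hord]
    exact Nat.card_zmultiples _
  rw [← hcard]
  refine Finset.card_le_card fun x hx => ?_
  simp only [Set.mem_toFinset, SetLike.mem_coe] at hx
  rw [Finset.mem_inter]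
  obtain ⟨z, rfl⟩ := AddSubgroup.mem_zmultiples_iff.1 hx
  refine ⟨mem_symmProg_of_mem_zmultiples hg ?_, mem_symmProg_of_mem_zmultiples hh ?_⟩
  · exact AddSubgroup.zsmul_mem _ (AddSubgroup.nsmul_mem _ (AddSubgroup.mem_zmultiples g) e) z
  · refine AddSubgroup.zsmul_mem _ (ZMod.mem_zmultiples_of_nsmul_eq_zero ?_) z
    rw [← addOrderOf_dvd_iff_nsmul_eq_zero, hord]
    exact Nat.gcd_dvd_right _ _

lemma Nat.mul_mul_dvd_mul_gcds {a b c n : ℕ} (ha : a ∣ n) (hb : b ∣ n) (hc : c ∣ n) :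
    a * b * c ∣ n * (a.gcd b * (a.gcd c * b.gcd c)) := by
  have h1 : (a.lcm b).lcm c ∣ n := Nat.lcm_dvd (Nat.lcm_dvd ha hb) hc
  have h2 : (a.lcm b).gcd c ∣ a.gcd c * b.gcd c :=
    (Nat.gcd_dvd_gcd_of_dvd_left c (Nat.lcm_dvd_mul a b)).trans
      (Nat.gcd_mul_left_dvd_mul_gcd c a b)
  have h3 : a * b * c = (a.lcm b).lcm c * (a.gcd b * (a.lcm b).gcd c) := by
    rw [← Nat.gcd_mul_lcm a b, mul_assoc, ← Nat.gcd_mul_lcm (a.lcm b) c]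
    ring
  rw [h3]
  exact mul_dvd_mul h1 (mul_dvd_mul_left _ h2)

namespace UI

variable {L M : ℕ} {I : Fin M → Finset (ZMod L)}

/-- The users in `S` leave at least `M - |S|` elements of `I i` uncovered, since otherwise each
of the remaining users could cover one of them. -/
lemma le_card_add_card_sdiff (hUI : UI I) (hne : ∀ j, (I j).Nonempty) {i : Fin M}
    {S : Finset (Fin M)} (hi : i ∉ S) (σ : Fin M → ZMod L) :
    M ≤ S.card + (I i \ S.biUnion fun j => shiftF (I j) (σ j)).card := by
  classical
  by_contra! hlt
  set C := I i \ S.biUnion fun j => shiftF (I j) (σ j) with hC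
  set R := Finset.univ \ insert i S with hR
  have hRcard : R.card = M - (S.card + 1) := by
    rw [hR, Finset.card_univ_sdiff, Fintype.card_fin, Finset.card_insert_of_notMem hi]
  obtain ⟨f, hfR, hfinj⟩ : ∃ f : C → Fin M, (∀ c, f c ∈ R) ∧ Function.Injective f := by
    have hle : Fintype.card C ≤ Fintype.card R := by
      rw [Fintype.card_coe, Fintype.card_coe, hRcard]
      omega
    obtain ⟨e⟩ := Function.Embedding.nonempty_of_card_le hle
    exact ⟨fun c => e c, fun c => (e c).2, Subtype.val_injective.comp e.injective⟩
  choose b hb using hne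
  let τ : Fin M → ZMod L := fun j =>
    if j ∈ S then σ j else if h : ∃ c, f c = j then (h.choose : ZMod L) - b j else 0
  refine hUI i τ fun x hx => ?_
  by_cases hxC : x ∈ C
  · have hfR' := hfR ⟨x, hxC⟩
    simp only [hR, Finset.mem_sdiff, Finset.mem_insert, not_or] at hfR'
    have hex : ∃ c, f c = f ⟨x, hxC⟩ := ⟨_, rfl⟩
    have hch : hex.choose = ⟨x, hxC⟩ := hfinj hex.choose_spec
    refine Finset.mem_biUnion.2 ⟨f ⟨x, hxC⟩, by simp [hfR'.2.1], ?_⟩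
    rw [mem_shiftF]
    simp only [τ, if_neg hfR'.2.2, dif_pos hex, hch]
    simpa using hb _
  · simp only [hC, Finset.mem_sdiff, hx, true_and, not_not, Finset.mem_biUnion] at hxC
    obtain ⟨j, hj, hxj⟩ := hxC
    refine Finset.mem_biUnion.2 ⟨j, ?_, by simpa [τ, hj] using hxj⟩
    simp only [Finset.mem_erase, Finset.mem_univ, and_true]
    rintro rfl
    exact hi hj

variable {g : Fin M → ZMod L}

lemma card_inter_shiftF_le (hUI : UI I) (hI : ∀ i, EquiDiff (I i) (M + 1) (g i))
    {i j : Fin M} (hij : i ≠ j) (τ : ZMod L) : (I i ∩ shiftF (I j) τ).card ≤ 2 := by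
  have h := hUI.le_card_add_card_sdiff (fun k => (hI k).nonempty) (S := {j})
    (by simpa using hij) (fun _ => τ)
  rw [Finset.singleton_biUnion, Finset.card_singleton] at h
  have := Finset.card_sdiff_add_card_inter (I i) (shiftF (I j) τ)
  rw [(hI i).2] at this
  omega

lemma card_symmProg_inter_le (hUI : UI I) (hI : ∀ i, EquiDiff (I i) (M + 1) (g i))
    {i j : Fin M} (hij : i ≠ j) : (symmProg (g i) M ∩ symmProg (g j) M).card ≤ 8 := by
  have key : ∀ s t, (shiftF (I i) s ∩ shiftF (I j) t).card ≤ 2 := fun s t => by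
    rw [card_shiftF_inter_shiftF]
    exact hUI.card_inter_shiftF_le hI hij _
  have hsub := Finset.inter_subset_inter (hI i).symmProg_subset (hI j).symmProg_subset
  refine (Finset.card_le_card hsub).trans ?_
  rw [Finset.union_inter_distrib_right, Finset.inter_union_distrib_left,
    Finset.inter_union_distrib_left]
  refine (Finset.card_union_le _ _).trans ?_
  refine (Nat.add_le_add (Finset.card_union_le _ _) (Finset.card_union_le _ _)).trans ?_
  linarith [key 0 0, key 0 (-(M * g j)), key (-(M * g i)) 0, key (-(M * g i)) (-(M * g j))]

end UI

lemma exists_pairs_disjoint {M a b : ℕ} (hM : 4 ≤ M) (ha : 1 ≤ a) (haM : a < M) (hb : 1 ≤ b)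
    (hbM : b < M) : ∃ x y : ℕ, x + a ≤ M ∧ y + b ≤ M ∧
      x ≠ y ∧ x ≠ y + b ∧ x + a ≠ y ∧ x + a ≠ y + b := by
  by_cases h1 : a = b
  · by_cases h2 : b = 1
    · exact ⟨2, 0, by omega⟩
    · exact ⟨1, 0, by omega⟩
  · rcases Nat.lt_or_gt_of_ne h1 with h | h
    · by_cases h2 : a + 1 = b
      · by_cases h3 : b = 2
        · exact ⟨3, 0, by omega⟩
        · exact ⟨2, 0, by omega⟩
      · exact ⟨1, 0, by omega⟩
    · by_cases h2 : b + 1 = a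
      · by_cases h3 : a = 2
        · exact ⟨0, 3, by omega⟩
        · exact ⟨0, 2, by omega⟩
      · exact ⟨0, 1, by omega⟩

/-- The nonzero multiples `a * g` with `|a| ≤ m`. -/
noncomputable def symmProgNe {L : ℕ} (g : ZMod L) (m : ℕ) : Finset (ZMod L) :=
  (symmProg g m).erase 0

lemma exists_pos_mul_mem_of_symmProgNe_inter {L m n : ℕ} {g h : ZMod L}
    (hne : (symmProgNe g m ∩ symmProgNe h n).Nonempty) :
    ∃ a : ℕ, 1 ≤ a ∧ a ≤ m ∧ (a : ZMod L) * g ∈ symmProg h n := by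
  obtain ⟨x, hx⟩ := hne
  simp only [symmProgNe, Finset.mem_inter, Finset.mem_erase] at hx
  obtain ⟨⟨hx0, hxg⟩, -, hxh⟩ := hx
  obtain ⟨a, ha, rfl⟩ := mem_symmProg.1 hxg
  have ha0 : a ≠ 0 := by
    rintro rfl
    simp at hx0
  rcases le_total 0 a with h0 | h0
  · lift a to ℕ using h0
    exact ⟨a, by omega, by omega, by simpa using hxh⟩
  · obtain ⟨b, hb⟩ := Int.eq_ofNat_of_zero_le (show 0 ≤ -a by omega)
    obtain rfl : a = -(b : ℤ) := by omega
    exact ⟨b, by omega, by omega, by simpa using neg_mem_symmProg hxh⟩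

namespace UI

variable {L M : ℕ} {I : Fin M → Finset (ZMod L)} {g : Fin M → ZMod L}

/-- The difference set of a user, without its two extreme differences, meets that of at most one
other user. -/
lemma eq_of_symmProgNe_inter (hUI : UI I) (hI : ∀ i, EquiDiff (I i) (M + 1) (g i)) (hM : 4 ≤ M)
    {i j k : Fin M} (hij : i ≠ j) (hik : i ≠ k)
    (hj : (symmProgNe (g i) (M - 1) ∩ symmProgNe (g j) (M - 1)).Nonempty)
    (hk : (symmProgNe (g i) (M - 1) ∩ symmProgNe (g k) (M - 1)).Nonempty) : j = k := by
  by_contra hjk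
  obtain ⟨a, ha, haM, haj⟩ := exists_pos_mul_mem_of_symmProgNe_inter hj
  obtain ⟨b, hb, hbM, hbk⟩ := exists_pos_mul_mem_of_symmProgNe_inter hk
  obtain ⟨x, y, hx, hy, hxy⟩ :=
    exists_pairs_disjoint hM ha (by omega : a < M) hb (by omega : b < M)
  obtain ⟨s, hs1, hs2⟩ := (hI j).exists_shift (symmProg_mono _ (Nat.sub_le M 1) haj) (x * g i)
  obtain ⟨t, ht1, ht2⟩ := (hI k).exists_shift (symmProg_mono _ (Nat.sub_le M 1) hbk) (y * g i)
  set U := ({j, k} : Finset (Fin M)).biUnion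
    fun l => shiftF (I l) ((if l = j then s else t : ZMod L)) with hU
  have h := hUI.le_card_add_card_sdiff (fun k => (hI k).nonempty) (i := i) (S := {j, k})
    (by simp [hij, hik]) (fun l => if l = j then s else t)
  rw [Finset.card_pair hjk, ← hU] at h
  have hsum := Finset.card_sdiff_add_card_inter (I i) U
  rw [(hI i).2] at hsum
  have hinj : Set.InjOn (fun n : ℕ => (n : ZMod L) * g i)
      (({x, x + a, y, y + b} : Finset ℕ) : Set ℕ) := by
    intro p hp q hq hpq
    simp only [Finset.coe_insert, Finset.coe_singleton, Set.mem_insert_iff,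
      Set.mem_singleton_iff] at hp hq
    exact (hI i).natCast_mul_inj (by omega) (by omega) hpq
  have hfour : (({x, x + a, y, y + b} : Finset ℕ).image
      fun n : ℕ => (n : ZMod L) * g i).card = 4 := by
    rw [Finset.card_image_of_injOn hinj, Finset.card_insert_of_notMem,
      Finset.card_insert_of_notMem, Finset.card_pair]
    · omega
    · simp only [Finset.mem_insert, Finset.mem_singleton]
      omega
    · simp only [Finset.mem_insert, Finset.mem_singleton]
      omega
  have hsub : (({x, x + a, y, y + b} : Finset ℕ).image
      fun n : ℕ => (n : ZMod L) * g i) ⊆ I i ∩ U := by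
    intro z hz
    simp only [Finset.image_insert, Finset.image_singleton, Finset.mem_insert,
      Finset.mem_singleton, Nat.cast_add, add_mul] at hz
    have hkj : k ≠ j := fun e => hjk e.symm
    refine Finset.mem_inter.2 ⟨(hI i).mem_iff.2 ?_, ?_⟩
    · rcases hz with rfl | rfl | rfl | rfl
      · exact ⟨x, by omega, rfl⟩
      · exact ⟨x + a, by omega, by push_cast; ring⟩
      · exact ⟨y, by omega, rfl⟩
      · exact ⟨y + b, by omega, by push_cast; ring⟩
    · simp only [hU, Finset.biUnion_insert, Finset.singleton_biUnion, Finset.mem_union, if_true,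
        if_neg hkj]
      rcases hz with rfl | rfl | rfl | rfl
      · exact Or.inl hs1
      · exact Or.inl hs2
      · exact Or.inr ht1
      · exact Or.inr ht2
  have := Finset.card_le_card hsub
  omega

lemma card_symmProgNe_sdiff (hUI : UI I) (hI : ∀ i, EquiDiff (I i) (M + 1) (g i)) (hM : 4 ≤ M)
    (i : Fin M) : (symmProgNe (g i) (M - 1)).card ≤ (symmProgNe (g i) (M - 1) \
      (Finset.univ.erase i).biUnion fun j => symmProgNe (g j) (M - 1)).card + 8 := by
  rw [← Finset.card_sdiff_add_card_inter (symmProgNe (g i) (M - 1))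
    ((Finset.univ.erase i).biUnion fun j => symmProgNe (g j) (M - 1))]
  refine Nat.add_le_add_left ?_ _
  by_cases h : ∃ j, i ≠ j ∧ (symmProgNe (g i) (M - 1) ∩ symmProgNe (g j) (M - 1)).Nonempty
  · obtain ⟨j, hij, hj⟩ := h
    refine le_trans (Finset.card_le_card ?_) (hUI.card_symmProg_inter_le hI hij)
    intro x hx
    simp only [Finset.mem_inter, Finset.mem_biUnion, Finset.mem_erase, Finset.mem_univ,
      and_true] at hx
    obtain ⟨hxi, k, hki, hxk⟩ := hx
    obtain rfl := hUI.eq_of_symmProgNe_inter hI hM hij hki.symm hj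
      ⟨x, Finset.mem_inter.2 ⟨hxi, hxk⟩⟩
    exact Finset.mem_inter.2
      ⟨symmProg_mono _ (Nat.sub_le M 1) (Finset.mem_of_mem_erase hxi),
        symmProg_mono _ (Nat.sub_le M 1) (Finset.mem_of_mem_erase hxk)⟩
  · push Not at h
    rw [Finset.card_eq_zero.2]
    · omega
    · rw [Finset.inter_biUnion, Finset.eq_empty_iff_forall_notMem]
      intro x hx
      obtain ⟨j, hj, hxj⟩ := Finset.mem_biUnion.1 hx
      rw [h j (Finset.ne_of_mem_erase hj).symm] at hxj
      exact Finset.notMem_empty x hxj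

lemma sum_card_symmProgNe_le [NeZero L] (hUI : UI I)
    (hI : ∀ i, EquiDiff (I i) (M + 1) (g i)) (hM : 4 ≤ M) (T : Finset (Fin M)) :
    ∑ i ∈ T, ((symmProgNe (g i) (M - 1)).card - 8) ≤ L := by
  set D : Fin M → Finset (ZMod L) := fun i => symmProgNe (g i) (M - 1) \
      (Finset.univ.erase i).biUnion fun j => symmProgNe (g j) (M - 1) with hD
  have hdisj : (T : Set (Fin M)).PairwiseDisjoint D := by
    intro i _ j _ hij
    refine Finset.disjoint_left.2 fun x hxi hxj => ?_
    simp only [hD, Finset.mem_sdiff, Finset.mem_biUnion, not_exists, not_and] at hxi hxj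
    exact hxi.2 j (by simp [hij.symm]) hxj.1
  calc ∑ i ∈ T, ((symmProgNe (g i) (M - 1)).card - 8)
      ≤ ∑ i ∈ T, (D i).card := Finset.sum_le_sum fun i _ => by
        have := hUI.card_symmProgNe_sdiff hI hM i
        simp only [hD]
        omega
    _ = (T.biUnion D).card := (Finset.card_biUnion hdisj).symm
    _ ≤ Fintype.card (ZMod L) := Finset.card_le_univ _
    _ = L := ZMod.card L

lemma card_addOrderOf_le [NeZero L] (hUI : UI I)
    (hI : ∀ i, EquiDiff (I i) (M + 1) (g i)) (hlt : 512 * L < M ^ 3) :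
    (Finset.univ.filter fun i => addOrderOf (g i) ≤ 2 * M).card ≤ 2 := by
  by_contra! h3
  obtain ⟨i, j, k, hi, hj, hk, hij, hik, hjk⟩ := Finset.two_lt_card_iff.1 h3
  simp only [Finset.mem_filter, Finset.mem_univ, true_and] at hi hj hk
  have hdvd : ∀ l, addOrderOf (g l) ∣ L := fun l => by
    simpa using addOrderOf_dvd_card (x := g l)
  have hgcd : ∀ {l l' : Fin M}, addOrderOf (g l) ≤ 2 * M → addOrderOf (g l') ≤ 2 * M → l ≠ l' →
      (addOrderOf (g l)).gcd (addOrderOf (g l')) ≤ 8 := fun h h' hne =>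
    (gcd_addOrderOf_le_card_inter h h').trans (hUI.card_symmProg_inter_le hI hne)
  have hle := Nat.le_of_dvd (by
    have := NeZero.pos L
    have := addOrderOf_pos (g i)
    have := addOrderOf_pos (g j)
    positivity) (Nat.mul_mul_dvd_mul_gcds (hdvd i) (hdvd j) (hdvd k))
  have hup : L * ((addOrderOf (g i)).gcd (addOrderOf (g j)) *
      ((addOrderOf (g i)).gcd (addOrderOf (g k)) * (addOrderOf (g j)).gcd (addOrderOf (g k)))) ≤
      L * (8 * (8 * 8)) :=
    Nat.mul_le_mul_left _ (Nat.mul_le_mul (hgcd hi hj hij)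
      (Nat.mul_le_mul (hgcd hi hk hik) (hgcd hj hk hjk)))
  have hlow : M * M * M ≤ addOrderOf (g i) * addOrderOf (g j) * addOrderOf (g k) :=
    Nat.mul_le_mul (Nat.mul_le_mul (hI i).lt_addOrderOf.le (hI j).lt_addOrderOf.le)
      (hI k).lt_addOrderOf.le
  have : M ^ 3 = M * M * M := by ring
  omega

lemma mul_le_length (hL : 0 < L) (hUI : UI I) (hI : ∀ i, EquiDiff (I i) (M + 1) (g i))
    (hM : 4 ≤ M) (hlt : 512 * L < M ^ 3) : (M - 2) * (2 * M - 10) ≤ L := by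
  have : NeZero L := ⟨hL.ne'⟩
  set T := Finset.univ \ Finset.univ.filter fun i => addOrderOf (g i) ≤ 2 * M with hT
  have hTcard : M - 2 ≤ T.card := by
    rw [hT, Finset.card_univ_sdiff, Fintype.card_fin]
    exact Nat.sub_le_sub_left (hUI.card_addOrderOf_le hI hlt) M
  calc (M - 2) * (2 * M - 10) ≤ T.card * (2 * M - 10) := Nat.mul_le_mul_right _ hTcard
    _ = ∑ _i ∈ T, (2 * M - 10) := by simp
    _ ≤ ∑ i ∈ T, ((symmProgNe (g i) (M - 1)).card - 8) := Finset.sum_le_sum fun i hi => by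
        simp only [hT, Finset.mem_sdiff, Finset.mem_filter, Finset.mem_univ, true_and, not_le] at hi
        rw [symmProgNe, Finset.card_erase_of_mem (mem_symmProg.2 ⟨0, by omega, by simp⟩),
          card_symmProg (by omega)]
        omega
    _ ≤ L := hUI.sum_card_symmProgNe_le hI hM T

end UI

theorem stmt14 : ∀ ε : ℝ, 0 < ε → ∃ M₀ : ℕ, ∀ M : ℕ, M₀ ≤ M → ∀ L : ℕ, 0 < L →
    ∀ I : Fin M → Finset (ZMod L),
      UI I → (∀ i, ∃ g : ZMod L, EquiDiff (I i) (M + 1) g) →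
      (1 - ε) * (2 * (M : ℝ) ^ 2) ≤ (L : ℝ) := by
  intro ε hε
  refine ⟨max 1024 ⌈7 / ε⌉₊, fun M hM L hL I hUI hI => ?_⟩
  choose g hg using hI
  have hM1 : 1024 ≤ M := (le_max_left _ _).trans hM
  have hM2 : 7 ≤ M * ε := by
    rw [← div_le_iff₀ hε]
    exact (Nat.le_ceil _).trans (by exact_mod_cast (le_max_right _ _).trans hM)
  have hpos : (0 : ℝ) ≤ M := Nat.cast_nonneg M
  by_cases hbig : 2 * M ^ 2 ≤ L
  · have h1 : (2 * (M : ℝ) ^ 2) ≤ L := by exact_mod_cast hbig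
    nlinarith [mul_nonneg hε.le (sq_nonneg (M : ℝ))]
  · have hlt : 512 * L < M ^ 3 := by
      have : 1024 * M ^ 2 ≤ M ^ 3 := by
        rw [pow_succ' M 2]
        exact Nat.mul_le_mul_right _ hM1
      omega
    have h := hUI.mul_le_length hL hg (by omega) hlt
    have h' : ((M : ℝ) - 2) * (2 * M - 10) ≤ L := by
      have hc : (((M - 2) * (2 * M - 10) : ℕ) : ℝ) ≤ L := by exact_mod_cast h
      rw [Nat.cast_mul, Nat.cast_sub (by omega), Nat.cast_sub (by omega)] at hc
      push_cast at hc
      exact hc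
    nlinarith [mul_le_mul_of_nonneg_left hM2 hpos]
end

section
/- For every real ε > 0 there are infinitely many integers M for which there exist a positive integer L with L ≤ (1+ε)·2M² and a user-irrepressible family (I_1, …, I_M) of subsets of Z_L in which every I_i is equi-difference of Hamming weight M+1. -/
/-- If `p` is prime and multiples `d * (1 + a * (2 * p - 1))`, `e * (1 + b * (2 * p - 1))` with
`|d|, |e| < p` and `a`, `b` distinct modulo `p` agree modulo `p * (2 * p - 1)`, then `d = 0`. -/
theorem eq_zero_of_dvd_mul_sub_mul {p : ℕ} (hp : p.Prime) {a b d e : ℤ}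
    (hd : |d| < p) (he : |e| < p) (hab : ¬ (p : ℤ) ∣ a - b)
    (h : (p : ℤ) * (2 * p - 1) ∣ d * (1 + a * (2 * p - 1)) - e * (1 + b * (2 * p - 1))) :
    d = 0 := by
  have hp2 : (2 : ℤ) ≤ p := by exact_mod_cast hp.two_le
  rw [abs_lt] at hd he
  have hde : d = e := by
    have hq : (2 * p - 1 : ℤ) ∣ d - e := by
      have h₁ := dvd_sub (dvd_of_mul_left_dvd h) (dvd_mul_left (2 * p - 1 : ℤ) (d * a - e * b))
      ring_nf at h₁ ⊢
      exact h₁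
    have := Int.eq_zero_of_abs_lt_dvd hq (abs_lt.2 ⟨by lia, by lia⟩)
    lia
  subst hde
  have h₁ : (p : ℤ) ∣ d * (a - b) := by
    refine Int.dvd_of_mul_dvd_mul_right (a := 2 * p - 1) (by lia) ?_
    convert h using 1
    ring
  rcases (Nat.prime_iff_prime_int.1 hp).dvd_or_dvd h₁ with h₂ | h₂
  · exact Int.eq_zero_of_abs_lt_dvd h₂ (abs_lt.2 hd)
  · exact absurd h₂ hab

/-- The equi-difference subset of `ZMod L` of length `w` with generator `g`. -/
def multiplesBelow {L : ℕ} (w : ℕ) (g : ZMod L) : Finset (ZMod L) :=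
  (Finset.range w).image fun t : ℕ => (t : ZMod L) * g

/-- Sets of more than `M - 1` elements, any two of which share at most one element under every
relative shift, form a user-irrepressible family. -/
theorem UI.of_inter_subsingleton {L M : ℕ} {I : Fin M → Finset (ZMod L)}
    (hcard : ∀ i, M ≤ (I i).card)
    (hI : ∀ i j, i ≠ j → ∀ τ, ∀ x ∈ I i, ∀ y ∈ I i, x ∈ shiftF (I j) τ → y ∈ shiftF (I j) τ →
      x = y) : UI I := by
  intro i τ hsub
  have : Nonempty (Fin M) := ⟨i⟩
  have hex : ∀ x ∈ I i, ∃ j ∈ Finset.univ.erase i, x ∈ shiftF (I j) (τ j) := fun x hx =>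
    Finset.mem_biUnion.1 (hsub hx)
  choose! f hf hmem using hex
  have hlt : (Finset.univ.erase i).card < (I i).card := by
    have := hcard i
    have := i.pos
    rw [Finset.card_erase_of_mem (Finset.mem_univ i), Finset.card_fin]
    lia
  obtain ⟨x, hx, y, hy, hxy, hfxy⟩ := Finset.exists_ne_map_eq_of_card_lt_of_maps_to hlt hf
  refine hxy (hI i (f x) (Finset.ne_of_mem_erase (hf x hx)).symm _ x hx y hy (hmem x hx) ?_)
  rw [hfxy]
  exact hmem y hy

/-- Distinct generators `1 + a * (2 * p - 1)` modulo `p * (2 * p - 1)`, for `a < p`, give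
equi-difference sets of weight `p` that share at most one element under every relative shift. -/
theorem multiplesBelow_inter_subsingleton {p L : ℕ} (hp : p.Prime)
    (hL : (L : ℤ) = p * (2 * p - 1)) {a b : ℕ} (ha : a < p) (hb : b < p) (hab : a ≠ b)
    {τ x y : ZMod L}
    (hx : x ∈ multiplesBelow p ((1 + a * (2 * p - 1) : ℤ) : ZMod L))
    (hy : y ∈ multiplesBelow p ((1 + a * (2 * p - 1) : ℤ) : ZMod L))
    (hx' : x ∈ shiftF (multiplesBelow p ((1 + b * (2 * p - 1) : ℤ) : ZMod L)) τ)
    (hy' : y ∈ shiftF (multiplesBelow p ((1 + b * (2 * p - 1) : ℤ) : ZMod L)) τ) :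
    x = y := by
  simp only [shiftF, multiplesBelow, Finset.mem_image, Finset.mem_range, exists_exists_and_eq_and]
    at hx hy hx' hy'
  obtain ⟨t, ht, rfl⟩ := hx
  obtain ⟨u, hu, rfl⟩ := hy
  obtain ⟨r, hr, hxr⟩ := hx'
  obtain ⟨s, hs, hys⟩ := hy'
  have key : (t - u : ℤ) = 0 := by
    refine eq_zero_of_dvd_mul_sub_mul (a := a) (b := b) (e := r - s) hp
      (abs_lt.2 ⟨by lia, by lia⟩) (abs_lt.2 ⟨by lia, by lia⟩) (fun h => ?_) ?_
    · have := Int.eq_zero_of_abs_lt_dvd h (abs_lt.2 ⟨by lia, by lia⟩)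
      lia
    · rw [← hL, ← CharP.intCast_eq_zero_iff (ZMod L) L]
      push_cast at hxr hys ⊢
      linear_combination hys - hxr
  obtain rfl : t = u := by lia
  rfl

theorem card_multiplesBelow {p L : ℕ} (hL : (L : ℤ) = p * (2 * p - 1)) (a : ℕ) :
    (multiplesBelow p ((1 + a * (2 * p - 1) : ℤ) : ZMod L)).card = p := by
  rw [multiplesBelow, Finset.card_image_of_injOn, Finset.card_range]
  intro t ht u hu htu
  simp only [Finset.coe_range, Set.mem_Iio] at ht hu
  have h : (L : ℤ) ∣ (t - u) * (1 + a * (2 * p - 1)) := by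
    rw [← CharP.intCast_eq_zero_iff (ZMod L) L]
    push_cast at htu ⊢
    linear_combination htu
  rw [hL] at h
  have hq : (2 * p - 1 : ℤ) ∣ t - u := by
    have h₁ := dvd_sub (dvd_of_mul_left_dvd h) (dvd_mul_left (2 * p - 1 : ℤ) ((t - u) * a))
    ring_nf at h₁ ⊢
    exact h₁
  have := Int.eq_zero_of_abs_lt_dvd hq (abs_lt.2 ⟨by lia, by lia⟩)
  lia

theorem stmt15 : ∀ ε : ℝ, 0 < ε → ∀ N : ℕ, ∃ M : ℕ, N ≤ M ∧
    ∃ L : ℕ, 0 < L ∧ (L : ℝ) ≤ (1 + ε) * (2 * (M : ℝ) ^ 2) ∧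
      ∃ I : Fin M → Finset (ZMod L),
        UI I ∧ ∀ i, ∃ g : ZMod L, EquiDiff (I i) (M + 1) g := by
  intro ε hε N
  obtain ⟨K, hK⟩ := exists_nat_gt (2 / ε)
  obtain ⟨p, hNp, hp⟩ := Nat.exists_infinite_primes (N + K + 2)
  obtain ⟨M, rfl⟩ : ∃ M, p = M + 1 := ⟨p - 1, by lia⟩
  have hL : (((M + 1) * (2 * M + 1) : ℕ) : ℤ) = (M + 1 : ℕ) * (2 * (M + 1 : ℕ) - 1) := by
    push_cast
    ring
  refine ⟨M, by lia, (M + 1) * (2 * M + 1), by positivity, ?_, fun i => multiplesBelow (M + 1)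
    ((1 + (i : ℕ) * (2 * (M + 1 : ℕ) - 1) : ℤ) : ZMod ((M + 1) * (2 * M + 1))), ?_, fun i => ?_⟩
  · have hM : (K : ℝ) + 1 ≤ M := by exact_mod_cast (by lia : K + 1 ≤ M)
    have hεM : 2 ≤ M * ε := (div_le_iff₀ hε).1 (by linarith)
    have hK0 : (0 : ℝ) ≤ K := K.cast_nonneg
    push_cast
    nlinarith [mul_le_mul_of_nonneg_right hεM (by linarith : (0 : ℝ) ≤ M)]
  · refine UI.of_inter_subsingleton (fun i => ?_) fun i j hij τ x hx y hy hx' hy' => ?_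
    · rw [card_multiplesBelow hL]
      lia
    · exact multiplesBelow_inter_subsingleton hp hL (by lia) (by lia)
        (Fin.val_injective.ne hij) hx hy hx' hy'
  · exact ⟨_, rfl, card_multiplesBelow hL i⟩
end

section
/- For every integer M ≥ 4 there exists a user-irrepressible family of M subsets of Z_{p(2M−1)}, each equi-difference of Hamming weight M+1, where p is the smallest prime with p > M. In particular, the smallest period L for which a user-irrepressible family of M equi-difference subsets of Z_L of Hamming weight M+1 exists is at most p(2M−1). -/
/-- If `1 + q * g` and `1 + q * h` have a common multiple modulo `p * q`, with `q = 2 * M - 1` and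
small multipliers `d` and `e`, then `d` is nearly maximal. -/
theorem eq_or_dvd_of_dvd_mul_sub_mul {M p q g h d e : ℤ} (hp : Prime p) (hM : 2 ≤ M)
    (hpM : M < p) (hq : q = 2 * M - 1) (hg : 0 ≤ g) (hgM : g < M) (hh : 0 ≤ h) (hhM : h < M)
    (hgh : g ≠ h) (hd : 1 ≤ d) (hdM : d ≤ M) (he : -M ≤ e) (heM : e ≤ M)
    (hdvd : p * q ∣ d * (1 + q * g) - e * (1 + q * h)) :
    d = M ∨ d = M - 1 ∧ p ∣ 1 + (M - 1) * g + M * h := by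
  have hq0 : q ≠ 0 := by omega
  have hqde : q ∣ d - e := by
    have h1 : q ∣ d * (1 + q * g) - e * (1 + q * h) := (Dvd.intro_left p rfl).trans hdvd
    have h2 : d - e = d * (1 + q * g) - e * (1 + q * h) - q * (d * g - e * h) := by ring
    rw [h2]
    exact dvd_sub h1 (Dvd.intro _ rfl)
  obtain ⟨c, hc⟩ := hqde
  have hc0 : 0 ≤ c := by
    by_contra! hneg
    nlinarith
  have hc2 : c < 2 := by
    by_contra! hlarge
    nlinarith
  have hpc : p ∣ c + (d * g - e * h) := by
    have h3 : d * (1 + q * g) - e * (1 + q * h) = (c + (d * g - e * h)) * q := by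
      linear_combination hc
    rw [h3] at hdvd
    exact Int.dvd_of_mul_dvd_mul_right hq0 hdvd
  obtain rfl | rfl : c = 0 ∨ c = 1 := by omega
  · exfalso
    obtain rfl : d = e := by linarith
    rw [zero_add, ← mul_sub] at hpc
    rcases hp.dvd_or_dvd hpc with h4 | h4
    · have := Int.le_of_dvd (by omega) h4
      omega
    · refine hgh (sub_eq_zero.mp (Int.eq_zero_of_abs_lt_dvd h4 ?_))
      rw [abs_lt]
      constructor <;> omega
  · by_cases hdM' : d = M
    · exact Or.inl hdM'
    · obtain rfl : d = M - 1 := by omega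
      obtain rfl : e = -M := by omega
      refine Or.inr ⟨rfl, ?_⟩
      convert hpc using 1
      ring

/-- The subset of `ZMod (p * q)` consisting of the first `M + 1` multiples of `1 + q * i`. -/
def progressionFamily (M p q : ℕ) (i : Fin M) : Finset (ZMod (p * q)) :=
  (Finset.range (M + 1)).image fun t : ℕ => (t : ZMod (p * q)) * (1 + q * (i : ℕ))

theorem equiDiff_progressionFamily {M p q : ℕ} (hMq : M < q) (i : Fin M) :
    EquiDiff (progressionFamily M p q i) (M + 1) (1 + q * (i : ℕ)) := by
  refine ⟨rfl, ?_⟩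
  unfold progressionFamily
  rw [Finset.card_image_of_injOn, Finset.card_range]
  intro a ha b hb hab
  simp only [Finset.coe_range, Set.mem_Iio] at ha hb
  have h1 := congrArg (ZMod.castHom (Dvd.intro_left p rfl) (ZMod q)) hab
  simp only [map_mul, map_add, map_one, map_natCast, CharP.cast_eq_zero, zero_mul, add_zero,
    mul_one] at h1
  have h2 := (ZMod.natCast_eq_natCast_iff' a b q).mp h1
  rwa [Nat.mod_eq_of_lt (by omega), Nat.mod_eq_of_lt (by omega)] at h2

theorem ui_progressionFamily {M p q : ℕ} (hM : 3 ≤ M) (hp : p.Prime) (hpM : M < p)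
    (hq : q = 2 * M - 1) : UI (progressionFamily M p q) := by
  intro i τ hsub
  have hcover : ∀ j : ℕ, ∃ f : Fin M, ∃ k : ℕ, j ≤ M → f ≠ i ∧ k ≤ M ∧
      (k : ZMod (p * q)) * (1 + q * (f : ℕ)) + τ f = j * (1 + q * (i : ℕ)) := by
    intro j
    by_cases hj : j ≤ M
    · have hmem := hsub (Finset.mem_image_of_mem _ (Finset.mem_range.mpr (Nat.lt_succ_of_le hj)))
      simp only [Finset.mem_biUnion, Finset.mem_erase, Finset.mem_univ, and_true, shiftF,
        progressionFamily, Finset.mem_image, Finset.mem_range, exists_exists_and_eq_and] at hmem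
      obtain ⟨f, hf, k, hk, hkj⟩ := hmem
      exact ⟨f, k, fun _ => ⟨hf, by omega, hkj⟩⟩
    · exact ⟨i, 0, fun h => absurd h hj⟩
  choose f k hfk using hcover
  have hcollide : ∀ a b : ℕ, a < b → b ≤ M → f a = f b →
      ((b : ℤ) - a = M ∨ (b : ℤ) - a = M - 1 ∧
        (p : ℤ) ∣ 1 + (M - 1) * (i : ℕ) + M * (f b : ℕ)) := by
    intro a b hab hb hf
    obtain ⟨-, hka, ha'⟩ := hfk a (by omega)
    obtain ⟨hfi, hkb, hb'⟩ := hfk b hb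
    rw [hf] at ha'
    have hne : (i : ℕ) ≠ f b := fun h => hfi (Fin.ext h.symm)
    refine eq_or_dvd_of_dvd_mul_sub_mul (q := q) (e := (k b : ℤ) - k a)
      (Nat.prime_iff_prime_int.mp hp) (by omega) (by omega) (by omega) (by omega) (by omega)
      (by omega) (by omega) (by omega) (by omega) (by omega) (by omega) (by omega) ?_
    rw [← Nat.cast_mul, ← ZMod.intCast_zmod_eq_zero_iff_dvd]
    push_cast
    linear_combination ha' - hb'
  have hpigeon : ∀ s : Finset ℕ, s.card = M → (∀ j ∈ s, j ≤ M) →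
      ∃ a ∈ s, ∃ b ∈ s, a < b ∧ f a = f b := by
    intro s hs hsM
    obtain ⟨a, ha, b, hb, hab, hf⟩ := Finset.exists_ne_map_eq_of_card_lt_of_maps_to
      (s := s) (t := Finset.univ.erase i) (f := f)
      (by rw [Finset.card_erase_of_mem (Finset.mem_univ _), Finset.card_fin]; omega)
      (fun j hj => by simpa using (hfk j (hsM j hj)).1)
    rcases lt_or_gt_of_ne hab with h | h
    · exact ⟨a, ha, b, hb, h, hf⟩
    · exact ⟨b, hb, a, ha, h, hf.symm⟩
  obtain ⟨a, ha, b, hb, hab, hf⟩ := hpigeon (Finset.Icc 1 M) (by simp)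
    (fun j hj => (Finset.mem_Icc.mp hj).2)
  obtain ⟨a', ha', b', hb', hab', hf'⟩ := hpigeon (Finset.range M) (by simp)
    (fun j hj => (Finset.mem_range.mp hj).le)
  simp only [Finset.mem_Icc, Finset.mem_range] at ha hb ha' hb'
  obtain ⟨hd, hdvd⟩ := (hcollide a b hab hb.2 hf).resolve_left (by omega)
  obtain ⟨hd', hdvd'⟩ := (hcollide a' b' hab' hb'.le hf').resolve_left (by omega)
  obtain ⟨rfl, rfl⟩ : a = 1 ∧ b = M := by omega
  obtain ⟨rfl, rfl⟩ : a' = 0 ∧ b' = b - 1 := by omega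
  have hdiff : (p : ℤ) ∣ b * ((f b : ℕ) - (f (b - 1) : ℕ)) := by
    simpa only [add_sub_add_left_eq_sub, ← mul_sub] using dvd_sub hdvd hdvd'
  rcases (Nat.prime_iff_prime_int.mp hp).dvd_or_dvd hdiff with h | h
  · have := Int.le_of_dvd (by omega) h
    omega
  · have heq := sub_eq_zero.mp (Int.eq_zero_of_abs_lt_dvd h (by rw [abs_lt]; omega))
    have hf01 : f 0 = f 1 := by
      rw [hf, hf']
      exact Fin.ext (by omega)
    have := hcollide 0 1 one_pos (by omega) hf01
    omega

theorem stmt16 (M p : ℕ) (hM : 4 ≤ M) (hp : p.Prime) (hpM : M < p)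
    (hmin : ∀ q : ℕ, q.Prime → M < q → p ≤ q) :
    (∃ I : Fin M → Finset (ZMod (p * (2 * M - 1))),
      UI I ∧ ∀ i, ∃ g : ZMod (p * (2 * M - 1)), EquiDiff (I i) (M + 1) g) ∧
    sInf {L : ℕ | 0 < L ∧ ∃ I : Fin M → Finset (ZMod L),
        UI I ∧ ∀ i, ∃ g : ZMod L, EquiDiff (I i) (M + 1) g} ≤ p * (2 * M - 1) := by
  have hUI := ui_progressionFamily (by omega) hp hpM rfl
  have hED : ∀ i, ∃ g, EquiDiff (progressionFamily M p (2 * M - 1) i) (M + 1) g :=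
    fun i => ⟨_, equiDiff_progressionFamily (by omega) i⟩
  exact ⟨⟨_, hUI, hED⟩, Nat.sInf_le ⟨Nat.mul_pos hp.pos (by omega), _, hUI, hED⟩⟩
end

section
/- For each integer M, let L^e_min(M) denote the least positive integer L for which there exists a user-irrepressible family of M subsets of Z_L, each equi-difference of Hamming weight M+1 (such an L exists for every M ≥ 4). Then liminf_{M→∞} L^e_min(M) / (2M²) = 1. -/
/-- `LminE M` is the least positive period `L` for which there exists a
user-irrepressible family of `M` equi-difference subsets of `ZMod L`,
each of Hamming weight `M + 1`. -/
noncomputable def LminE (M : ℕ) : ℕ :=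
  sInf {L : ℕ | 0 < L ∧ ∃ I : Fin M → Finset (ZMod L),
    UI I ∧ ∀ i, ∃ g : ZMod L, EquiDiff (I i) (M + 1) g}

open Finset

theorem EquiDiff.mem_iff_s17 {L w : ℕ} {S : Finset (ZMod L)} {g : ZMod L} (h : EquiDiff S w g)
    {x : ZMod L} : x ∈ S ↔ ∃ t : ℕ, t < w ∧ (t : ZMod L) * g = x := by
  rw [h.1]; simp

theorem EquiDiff.injOn {L w : ℕ} {S : Finset (ZMod L)} {g : ZMod L} (h : EquiDiff S w g) :
    Set.InjOn (fun t : ℕ => (t : ZMod L) * g) (range w) := by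
  apply Finset.card_image_iff.1
  rw [← h.1, h.2, card_range]

theorem EquiDiff.eq_zero {L w : ℕ} {S : Finset (ZMod L)} {g : ZMod L}
    (h : EquiDiff S (w + 1) g) {k : ℤ} (hk : |k| ≤ w) (h0 : (k : ZMod L) * g = 0) : k = 0 := by
  have key : ∀ n : ℕ, n ≤ w → (n : ZMod L) * g = 0 → n = 0 := fun n hn h0 =>
    h.injOn (x₁ := n) (x₂ := 0) (by simp; omega) (by simp) (by simpa using h0)
  obtain ⟨n, rfl | rfl⟩ := k.eq_nat_or_neg
  · exact_mod_cast key n (by simpa using hk) (by simpa using h0)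
  · have := key n (by simpa using hk) (by simpa using h0)
    simp [this]

theorem EquiDiff.intCast_mul_mem {L w : ℕ} {S : Finset (ZMod L)} {g : ZMod L}
    (h : EquiDiff S (w + 1) g) {k : ℤ} (h0 : 0 ≤ k) (hk : k ≤ w) : (k : ZMod L) * g ∈ S := by
  lift k to ℕ using h0
  exact h.mem_iff_s17.2 ⟨k, by omega, by simp⟩

theorem EquiDiff.mem_shiftF {L w : ℕ} {S : Finset (ZMod L)} {g : ZMod L}
    (h : EquiDiff S (w + 1) g) {a m : ℤ} (c : ZMod L) (h0 : m ≤ a) (hk : a ≤ m + w) :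
    c + (a : ZMod L) * g ∈ shiftF S (c + (m : ZMod L) * g) := by
  refine mem_image.2 ⟨_, h.intCast_mul_mem (k := a - m) (by omega) (by omega), ?_⟩
  push_cast
  ring

/-- Every sequence outside `J` can be shifted so as to hit a prescribed element of `I i`, so the
sequences in `J` cannot cover much more than one element each. -/
theorem UI.card_inter_le {L M : ℕ} {I : Fin M → Finset (ZMod L)} {g : Fin M → ZMod L} (hUI : UI I)
    (hI : ∀ i, EquiDiff (I i) (M + 1) (g i)) (i : Fin M) (J : Finset (Fin M)) (hJ : i ∉ J)
    (τ : Fin M → ZMod L) :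
    (I i ∩ J.biUnion fun j => shiftF (I j) (τ j)).card ≤ J.card + 1 := by
  by_contra! hc
  set C := J.biUnion fun j => shiftF (I j) (τ j) with hC
  set R := I i \ C with hR
  set T := (univ.erase i) \ J with hT
  have hRc : R.card + (I i ∩ C).card = M + 1 := by
    rw [hR, card_sdiff_add_card_inter, (hI i).2]
  have hTc : T.card + J.card = M - 1 := by
    rw [hT, card_sdiff_add_card_eq_card (fun j hj => by
      simp only [mem_erase, mem_univ, and_true]; rintro rfl; exact hJ hj)]
    simp
  have hle : R.card ≤ T.card := by omega
  obtain ⟨f⟩ : Nonempty (R ↪ T) := Function.Embedding.nonempty_of_card_le (by simpa using hle)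
  let σ : Fin M → ZMod L := fun j =>
    if j ∈ J then τ j else if h : ∃ r : R, (f r : Fin M) = j then (h.choose : ZMod L) else 0
  refine hUI i σ fun x hx => ?_
  by_cases hxC : x ∈ C
  · obtain ⟨j, hj, hxj⟩ := mem_biUnion.1 hxC
    refine mem_biUnion.2 ⟨j, ?_, by simpa [σ, hj] using hxj⟩
    simp only [mem_erase, mem_univ, and_true]
    rintro rfl
    exact hJ hj
  · have hxR : x ∈ R := mem_sdiff.2 ⟨hx, hxC⟩
    have hj := (f ⟨x, hxR⟩).2
    obtain ⟨hj1, hj2⟩ := mem_sdiff.1 hj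
    have hex : ∃ r : R, (f r : Fin M) = f ⟨x, hxR⟩ := ⟨_, rfl⟩
    have hσ : σ (f ⟨x, hxR⟩) = x := by
      simp only [σ, hj2, if_false, dif_pos hex]
      have := f.injective (Subtype.ext hex.choose_spec)
      rw [this]
    refine mem_biUnion.2 ⟨_, hj1, ?_⟩
    rw [hσ]
    have := (hI (f ⟨x, hxR⟩)).mem_shiftF (a := 0) (m := 0) x (by omega) (by omega)
    simpa using this

theorem UI.eq_zero_of_mul_eq {L M : ℕ} {I : Fin M → Finset (ZMod L)} {g : Fin M → ZMod L}
    (hUI : UI I) (hI : ∀ i, EquiDiff (I i) (M + 1) (g i)) {i j : Fin M} (hij : i ≠ j) {k l : ℤ}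
    (hk : 2 * |k| ≤ M) (hl : 2 * |l| ≤ M) (h : (k : ZMod L) * g i = l * g j) : k = 0 := by
  wlog hk0 : 0 ≤ k generalizing k l
  · have := @this (-k) (-l) (by simpa using hk) (by simpa using hl) (by simpa using h) (by omega)
    omega
  by_contra hne
  rw [abs_of_nonneg hk0] at hk
  obtain ⟨hl1, hl2⟩ := abs_le.1 (show |l| ≤ (M : ℤ) / 2 by omega)
  have hsub : (Icc (0 : ℤ) 2).image (fun s : ℤ => ((s * k : ℤ) : ZMod L) * g i) ⊆
      I i ∩ ({j} : Finset (Fin M)).biUnion fun j' => shiftF (I j')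
        ((fun _ => ((min 0 (2 * l) : ℤ) : ZMod L) * g j) j') := by
    intro x hx
    obtain ⟨s, hs, rfl⟩ := mem_image.1 hx
    rw [mem_Icc] at hs
    refine mem_inter.2 ⟨(hI i).intCast_mul_mem (by nlinarith) (by nlinarith), ?_⟩
    rw [singleton_biUnion]
    have := (hI j).mem_shiftF (a := s * l) (m := min 0 (2 * l)) 0
      (by obtain ⟨h1, h2⟩ := hs; interval_cases s <;> omega)
      (by obtain ⟨h1, h2⟩ := hs; interval_cases s <;> omega)
    rw [zero_add, zero_add] at this
    convert this using 1
    push_cast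
    rw [mul_assoc, h, mul_assoc]
  have hcard : ((Icc (0 : ℤ) 2).image (fun s : ℤ => ((s * k : ℤ) : ZMod L) * g i)).card = 3 := by
    rw [card_image_of_injOn]
    · simp
    · intro s hs t ht hst
      simp only [coe_Icc, Set.mem_Icc] at hs ht
      have h0 : (s - t) * k = 0 := (hI i).eq_zero (k := (s - t) * k)
        (by rw [abs_mul, abs_of_nonneg hk0]
            have : |s - t| ≤ 2 := abs_le.2 ⟨by omega, by omega⟩
            nlinarith)
        (by push_cast at hst ⊢; linear_combination hst)
      rcases mul_eq_zero.1 h0 with h0 | h0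
      · omega
      · exact absurd h0 hne
  have h1 := card_le_card hsub
  have h2 := hUI.card_inter_le hI i {j} (by simpa using hij)
    (fun _ => ((min 0 (2 * l) : ℤ) : ZMod L) * g j)
  have := h1.trans h2
  rw [hcard, card_singleton] at this
  omega

theorem UI.false_of_mul_eq_of_mul_eq {L M : ℕ} {I : Fin M → Finset (ZMod L)} {g : Fin M → ZMod L}
    (hUI : UI I) (hI : ∀ i, EquiDiff (I i) (M + 1) (g i)) {i j j' : Fin M} (hij : i ≠ j)
    (hij' : i ≠ j') (hjj : j ≠ j') {k l k' l' : ℤ} (hk : 0 < k) (hkM : k + 3 ≤ M)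
    (hl : |l| ≤ M) (h : (k : ZMod L) * g i = l * g j) (hk' : 0 < k') (hkM' : k' + 3 ≤ M)
    (hl' : |l'| ≤ M) (h' : (k' : ZMod L) * g i = l' * g j') : False := by
  obtain ⟨t, ht1, ht3, htk, htk'⟩ : ∃ t : ℤ, 1 ≤ t ∧ t ≤ 3 ∧ t ≠ k ∧ t + k' ≠ k := by
    by_contra! hc
    have := hc 1 (by omega) (by omega)
    have := hc 2 (by omega) (by omega)
    have := hc 3 (by omega) (by omega)
    omega
  rw [abs_le] at hl hl'
  let τ : Fin M → ZMod L := fun x => if x = j then 0 + ((min 0 l : ℤ) : ZMod L) * g j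
    else (t : ZMod L) * g i + ((min 0 l' : ℤ) : ZMod L) * g j'
  have hτ : τ j' = (t : ZMod L) * g i + ((min 0 l' : ℤ) : ZMod L) * g j' := by
    simp [τ, hjj.symm]
  have hsub : ({0, k, t, t + k'} : Finset ℤ).image (fun s : ℤ => (s : ZMod L) * g i) ⊆
      I i ∩ ({j, j'} : Finset (Fin M)).biUnion fun x => shiftF (I x) (τ x) := by
    intro x hx
    obtain ⟨s, hs, rfl⟩ := mem_image.1 hx
    simp only [mem_insert, mem_singleton] at hs
    refine mem_inter.2 ⟨(hI i).intCast_mul_mem (by omega) (by omega), ?_⟩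
    rw [biUnion_insert, singleton_biUnion, mem_union, hτ, show τ j = _ from if_pos rfl]
    rcases hs with rfl | rfl | rfl | rfl
    · left
      simpa using (hI j).mem_shiftF (a := 0) (m := min 0 l) 0 (by omega) (by omega)
    · left
      have := (hI j).mem_shiftF (a := l) (m := min 0 l) 0 (by omega) (by omega)
      simpa [← h] using this
    · right
      simpa using (hI j').mem_shiftF (a := 0) (m := min 0 l') ((s : ZMod L) * g i)
        (by omega) (by omega)
    · right
      have := (hI j').mem_shiftF (a := l') (m := min 0 l') ((t : ZMod L) * g i)
        (by omega) (by omega)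
      rwa [← h', ← add_mul, ← Int.cast_add] at this
  have hcard : (({0, k, t, t + k'} : Finset ℤ).image
      (fun s : ℤ => (s : ZMod L) * g i)).card = 4 := by
    rw [card_image_of_injOn]
    · rw [card_insert_of_notMem, card_insert_of_notMem, card_insert_of_notMem, card_singleton] <;>
        simp <;> omega
    · intro a ha b hb hab
      simp only [coe_insert, coe_singleton, Set.mem_insert_iff, Set.mem_singleton_iff] at ha hb
      have := (hI i).eq_zero (k := a - b) (abs_le.2 ⟨by omega, by omega⟩)
        (by push_cast; simp only at hab; linear_combination hab)
      omega
  have h1 := card_le_card hsub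
  have h2 := hUI.card_inter_le hI i {j, j'} (by simp [hij, hij']) τ
  rw [card_pair hjj] at h2
  omega

theorem UI.card_common_le {L M : ℕ} {I : Fin M → Finset (ZMod L)} {g : Fin M → ZMod L}
    (hUI : UI I) (hI : ∀ i, EquiDiff (I i) (M + 1) (g i)) (hM : 5 ≤ M) {i j : Fin M} (hij : i ≠ j)
    (S : Finset (ZMod L)) (hS : ∀ x ∈ S, ∃ k l : ℤ, |k| ≤ M ∧ |l| ≤ M ∧
      (k : ZMod L) * g i = x ∧ (l : ZMod L) * g j = x) : S.card ≤ 36 := by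
  by_contra! hc
  choose! k l hk hl hkx hlx using hS
  have cell : ∀ a : ℤ, |a| ≤ M → (a + M) / (M / 2 : ℤ) ∈ Ico (0 : ℤ) 6 := by
    intro a ha
    rw [abs_le] at ha
    have : (0 : ℤ) < M / 2 := by omega
    exact mem_Ico.2 ⟨Int.ediv_nonneg (by omega) (by omega), Int.ediv_lt_of_lt_mul this (by omega)⟩
  obtain ⟨x, hx, y, hy, hxy, he⟩ := exists_ne_map_eq_of_card_lt_of_maps_to
    (s := S) (t := Ico (0 : ℤ) 6 ×ˢ Ico (0 : ℤ) 6)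
    (f := fun x => ((k x + M) / (M / 2 : ℤ), (l x + M) / (M / 2 : ℤ)))
    (by simpa using hc) (fun x hx => mem_product.2 ⟨cell _ (hk x hx), cell _ (hl x hx)⟩)
  have close : ∀ a b : ℤ, (a + M) / (M / 2 : ℤ) = (b + M) / (M / 2 : ℤ) → 2 * |a - b| ≤ M := by
    intro a b hab
    have hpos : (0 : ℤ) < M / 2 := by omega
    have h1 := Int.mul_ediv_add_emod (a + M) (M / 2 : ℤ)
    have h2 := Int.mul_ediv_add_emod (b + M) (M / 2 : ℤ)
    rw [hab] at h1
    have h3 := Int.emod_nonneg (a + M) hpos.ne'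
    have h4 := Int.emod_nonneg (b + M) hpos.ne'
    have h5 := Int.emod_lt_of_pos (a + M) hpos
    have h6 := Int.emod_lt_of_pos (b + M) hpos
    have : |a - b| ≤ (M / 2 : ℤ) := abs_le.2 ⟨by omega, by omega⟩
    omega
  simp only [Prod.mk.injEq] at he
  have h0 := hUI.eq_zero_of_mul_eq hI hij (close _ _ he.1) (close _ _ he.2)
    (by push_cast; rw [sub_mul, sub_mul, hkx x hx, hkx y hy, hlx x hx, hlx y hy])
  apply hxy
  rw [← hkx x hx, ← hkx y hy, sub_eq_zero.1 h0]

theorem exists_intCast_mul_eq_of_mem_zmultiples {L M : ℕ} {g x : ZMod L} (hpos : 0 < addOrderOf g)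
    (hg : addOrderOf g ≤ 2 * M) (hx : x ∈ AddSubgroup.zmultiples g) :
    ∃ k : ℤ, |k| ≤ M ∧ (k : ZMod L) * g = x := by
  obtain ⟨s, rfl⟩ := AddSubgroup.mem_zmultiples_iff.1 hx
  set n : ℤ := (addOrderOf g : ℤ) with hn
  have hn0 : (0 : ℤ) < n := by omega
  have h1 := Int.emod_nonneg s hn0.ne'
  have h2 := Int.emod_lt_of_pos s hn0
  have h3 : (s % n) • g = s • g := mod_addOrderOf_zsmul g s
  by_cases hs : s % n ≤ M
  · exact ⟨s % n, abs_le.2 ⟨by omega, hs⟩, by rw [← h3, zsmul_eq_mul]⟩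
  · refine ⟨s % n - n, abs_le.2 ⟨by omega, by omega⟩, ?_⟩
    rw [← zsmul_eq_mul, sub_zsmul, h3, hn, natCast_zsmul, addOrderOf_nsmul_eq_zero, neg_zero,
      add_zero]

theorem mem_zmultiples_of_addOrderOf_dvd {G : Type*} [AddGroup G] [Finite G]
    [IsAddCyclic G] {g h : G} (hgh : addOrderOf h ∣ addOrderOf g) :
    h ∈ AddSubgroup.zmultiples g := by
  classical
  have := Fintype.ofFinite G
  have hpos : 0 < addOrderOf g := addOrderOf_pos g
  set T : Finset G := univ.filter fun x => addOrderOf g • x = 0 with hT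
  set Z : Finset G := univ.filter fun x => x ∈ AddSubgroup.zmultiples g with hZ
  have hsub : Z ⊆ T := by
    intro x hx
    obtain ⟨s, rfl⟩ := AddSubgroup.mem_zmultiples_iff.1 (mem_filter.1 hx).2
    refine mem_filter.2 ⟨mem_univ _, ?_⟩
    rw [← natCast_zsmul, ← mul_zsmul, mul_comm, mul_zsmul, natCast_zsmul,
      addOrderOf_nsmul_eq_zero, zsmul_zero]
  have hZc : Z.card = addOrderOf g := by
    rw [← Nat.card_zmultiples, Nat.card_eq_fintype_card, Fintype.card_subtype]
  have hTZ : Z = T := eq_of_subset_of_card_le hsub (by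
    rw [hZc]
    exact IsAddCyclic.card_nsmul_eq_zero_le hpos)
  have hh : h ∈ T := mem_filter.2 ⟨mem_univ _, addOrderOf_dvd_iff_nsmul_eq_zero.1 hgh⟩
  rw [← hTZ] at hh
  exact (mem_filter.1 hh).2

theorem UI.gcd_addOrderOf_le {L M : ℕ} [NeZero L] {I : Fin M → Finset (ZMod L)}
    {g : Fin M → ZMod L} (hUI : UI I) (hI : ∀ i, EquiDiff (I i) (M + 1) (g i)) (hM : 5 ≤ M)
    {i j : Fin M} (hij : i ≠ j) (hi : addOrderOf (g i) ≤ 2 * M) (hj : addOrderOf (g j) ≤ 2 * M) :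
    (addOrderOf (g i)).gcd (addOrderOf (g j)) ≤ 36 := by
  have hipos := addOrderOf_pos (g i)
  have hjpos := addOrderOf_pos (g j)
  set d := (addOrderOf (g i)).gcd (addOrderOf (g j)) with hd
  obtain ⟨c, hc⟩ : d ∣ addOrderOf (g i) := Nat.gcd_dvd_left _ _
  have hc0 : c ≠ 0 := by rintro rfl; omega
  have hord : addOrderOf (c • g i) = d := by
    rw [addOrderOf_nsmul_of_dvd hc0 ⟨d, by rw [hc, mul_comm]⟩, hc]
    exact Nat.mul_div_cancel _ (Nat.pos_of_ne_zero hc0)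
  set S : Finset (ZMod L) := univ.filter fun x => x ∈ AddSubgroup.zmultiples (c • g i) with hS
  have hSc : S.card = d := by
    rw [← hord, ← Nat.card_zmultiples, Nat.card_eq_fintype_card, Fintype.card_subtype]
  rw [← hSc]
  refine hUI.card_common_le hI hM hij S fun x hx => ?_
  have hx' := (mem_filter.1 hx).2
  have hxd : addOrderOf x ∣ d := hord ▸ addOrderOf_dvd_of_mem_zmultiples hx'
  obtain ⟨k, hk, hkx⟩ := exists_intCast_mul_eq_of_mem_zmultiples hipos hi
    (mem_zmultiples_of_addOrderOf_dvd (hxd.trans (Nat.gcd_dvd_left _ _)))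
  obtain ⟨l, hl, hlx⟩ := exists_intCast_mul_eq_of_mem_zmultiples hjpos hj
    (mem_zmultiples_of_addOrderOf_dvd (hxd.trans (Nat.gcd_dvd_right _ _)))
  exact ⟨k, l, hk, hl, hkx, hlx⟩

theorem mul_mul_le_of_dvd_of_gcd_le {a b c n D : ℕ} (hn : 0 < n) (ha : a ∣ n) (hb : b ∣ n)
    (hc : c ∣ n) (hab : a.gcd b ≤ D) (hac : a.gcd c ≤ D) (hbc : b.gcd c ≤ D) :
    a * b * c ≤ D ^ 3 * n := by
  have h1 : a.gcd b * a.lcm b = a * b := Nat.gcd_mul_lcm a b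
  have h2 : (a.lcm b).gcd c * (a.lcm b).lcm c = a.lcm b * c := Nat.gcd_mul_lcm _ c
  have h3 : (a.lcm b).gcd c ≤ a.gcd c * b.gcd c := by
    have hcpos : 0 < c := Nat.pos_of_dvd_of_pos hc hn
    refine Nat.le_of_dvd (Nat.mul_pos (Nat.gcd_pos_of_pos_right _ hcpos)
      (Nat.gcd_pos_of_pos_right _ hcpos)) ?_
    refine dvd_trans (Nat.gcd_dvd_gcd_of_dvd_left c (Nat.lcm_dvd_mul a b)) ?_
    exact Nat.gcd_mul_left_dvd_mul_gcd c a b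
  have h4 : (a.lcm b).lcm c ≤ n := Nat.le_of_dvd hn (Nat.lcm_dvd (Nat.lcm_dvd ha hb) hc)
  calc a * b * c = a.gcd b * ((a.lcm b).gcd c * (a.lcm b).lcm c) := by rw [h2, ← h1]; ring
    _ ≤ D * ((D * D) * n) := by
        gcongr
        exact h3.trans (Nat.mul_le_mul hac hbc)
    _ = D ^ 3 * n := by ring

theorem EquiDiff.lt_addOrderOf_s17 {L w : ℕ} [NeZero L] {S : Finset (ZMod L)} {g : ZMod L}
    (h : EquiDiff S (w + 1) g) : w < addOrderOf g := by
  by_contra! hc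
  have := h.eq_zero (k := addOrderOf g) (by simpa using hc) (by
    rw [Int.cast_natCast, ← nsmul_eq_mul, addOrderOf_nsmul_eq_zero])
  have := addOrderOf_pos g
  omega

theorem UI.card_addOrderOf_le_s17 {L M : ℕ} [NeZero L] {I : Fin M → Finset (ZMod L)}
    {g : Fin M → ZMod L} (hUI : UI I) (hI : ∀ i, EquiDiff (I i) (M + 1) (g i))
    (hM : 2 * 36 ^ 3 ≤ M) (hL : L ≤ 2 * M ^ 2) :
    (univ.filter fun i => addOrderOf (g i) ≤ 2 * M).card ≤ 2 := by
  by_contra! hc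
  obtain ⟨a, ha, b, hb, c, hc, hab, hac, hbc⟩ := two_lt_card.1 hc
  simp only [mem_filter, mem_univ, true_and] at ha hb hc
  have hM5 : 5 ≤ M := by omega
  have hdvd : ∀ x : ZMod L, addOrderOf x ∣ L := fun x => by
    simpa using addOrderOf_dvd_natCard x
  have h1 := mul_mul_le_of_dvd_of_gcd_le (Nat.pos_of_ne_zero (NeZero.ne L)) (hdvd (g a))
    (hdvd (g b)) (hdvd (g c)) (hUI.gcd_addOrderOf_le hI hM5 hab ha hb)
    (hUI.gcd_addOrderOf_le hI hM5 hac ha hc) (hUI.gcd_addOrderOf_le hI hM5 hbc hb hc)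
  have h2 : (M + 1) * (M + 1) * (M + 1) ≤ addOrderOf (g a) * addOrderOf (g b) * addOrderOf (g c) :=
    Nat.mul_le_mul (Nat.mul_le_mul (hI a).lt_addOrderOf_s17 (hI b).lt_addOrderOf_s17) (hI c).lt_addOrderOf_s17
  have h3 : 36 ^ 3 * L ≤ M * M ^ 2 := by
    calc 36 ^ 3 * L ≤ 36 ^ 3 * (2 * M ^ 2) := by gcongr
      _ = 2 * 36 ^ 3 * M ^ 2 := by ring
      _ ≤ M * M ^ 2 := by gcongr
  nlinarith

/-- The nonzero differences `k * g` with `|k| + 3 ≤ M`. -/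
noncomputable def shortDiff {L : ℕ} (M : ℕ) (g : ZMod L) : Finset (ZMod L) :=
  ((Icc (3 - M : ℤ) (M - 3)).erase 0).image fun k : ℤ => (k : ZMod L) * g

theorem mem_shortDiff {L M : ℕ} {g x : ZMod L} :
    x ∈ shortDiff M g ↔ ∃ k : ℤ, k ≠ 0 ∧ |k| + 3 ≤ M ∧ (k : ZMod L) * g = x := by
  simp only [shortDiff, mem_image, mem_erase, mem_Icc, ← le_sub_iff_add_le, abs_le, and_assoc,
    neg_sub]

theorem card_shortDiff {L M : ℕ} {g : ZMod L} (hM : 3 ≤ M) (hg : 2 * M < addOrderOf g) :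
    (shortDiff M g).card = 2 * M - 6 := by
  rw [shortDiff, card_image_of_injOn, card_erase_of_mem, Int.card_Icc]
  · omega
  · exact mem_Icc.2 ⟨by omega, by omega⟩
  · intro a ha b hb hab
    simp only [coe_erase, coe_Icc, Set.mem_sdiff, Set.mem_Icc] at ha hb
    have h0 : (a - b) • g = 0 := by
      rw [zsmul_eq_mul]
      push_cast
      simp only at hab
      linear_combination hab
    have h1 := Int.eq_zero_of_abs_lt_dvd (addOrderOf_dvd_iff_zsmul_eq_zero.2 h0)
      (abs_lt.2 ⟨by omega, by omega⟩)
    omega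

theorem UI.eq_of_mem_shortDiff {L M : ℕ} {I : Fin M → Finset (ZMod L)}
    {g : Fin M → ZMod L} (hUI : UI I) (hI : ∀ i, EquiDiff (I i) (M + 1) (g i)) {i j j' : Fin M}
    (hij : i ≠ j) (hij' : i ≠ j') {x y : ZMod L} (hxi : x ∈ shortDiff M (g i))
    (hxj : x ∈ shortDiff M (g j)) (hyi : y ∈ shortDiff M (g i)) (hyj : y ∈ shortDiff M (g j')) :
    j = j' := by
  by_contra hjj
  have pos : ∀ {j : Fin M} {x : ZMod L}, x ∈ shortDiff M (g i) → x ∈ shortDiff M (g j) →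
      ∃ k l : ℤ, 0 < k ∧ k + 3 ≤ M ∧ |l| ≤ M ∧ (k : ZMod L) * g i = l * g j := by
    intro j x hxi hxj
    obtain ⟨k, hk0, hk, rfl⟩ := mem_shortDiff.1 hxi
    obtain ⟨l, -, hl, hlk⟩ := mem_shortDiff.1 hxj
    rcases hk0.lt_or_gt with hneg | hpos
    · rw [abs_of_neg hneg] at hk
      exact ⟨-k, -l, by omega, hk, by rw [abs_neg]; omega, by simp [hlk]⟩
    · rw [abs_of_pos hpos] at hk
      exact ⟨k, l, hpos, hk, by omega, hlk.symm⟩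
  obtain ⟨k, l, hk, hkM, hl, h⟩ := pos hxi hxj
  obtain ⟨k', l', hk', hkM', hl', h'⟩ := pos hyi hyj
  exact hUI.false_of_mul_eq_of_mul_eq hI hij hij' hjj hk hkM hl h hk' hkM' hl' h'

theorem UI.le_length {L M : ℕ} [NeZero L] {I : Fin M → Finset (ZMod L)}
    {g : Fin M → ZMod L} (hUI : UI I) (hI : ∀ i, EquiDiff (I i) (M + 1) (g i))
    (hM : 2 * 36 ^ 3 ≤ M) : (M - 2) * (2 * M - 42) ≤ L := by
  by_cases hL : 2 * M ^ 2 < L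
  · calc (M - 2) * (2 * M - 42) ≤ M * (2 * M) := Nat.mul_le_mul (by omega) (by omega)
      _ = 2 * M ^ 2 := by ring
      _ ≤ L := hL.le
  push Not at hL
  set N : Finset (Fin M) := (univ.filter fun i => addOrderOf (g i) ≤ 2 * M)ᶜ with hN
  have hNc : M - 2 ≤ N.card := by
    have h1 := hUI.card_addOrderOf_le_s17 hI hM hL
    rw [hN, card_compl, Fintype.card_fin]
    omega
  let P : Fin M → Finset (ZMod L) := fun i =>
    shortDiff M (g i) \ (univ.erase i).biUnion fun j => shortDiff M (g j)
  have hPdisj : ∀ i ∈ N, ∀ j ∈ N, i ≠ j → Disjoint (P i) (P j) := by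
    intro i _ j _ hij
    refine Finset.disjoint_left.2 fun x hxi hxj => (mem_sdiff.1 hxi).2 ?_
    exact mem_biUnion.2 ⟨j, by simpa using hij.symm, (mem_sdiff.1 hxj).1⟩
  have hPc : ∀ i ∈ N, 2 * M - 42 ≤ (P i).card := by
    intro i hi
    have hc := card_shortDiff (g := g i) (M := M) (by omega) (by
      simpa [hN] using hi)
    by_cases hex : ∃ j, i ≠ j ∧ ∃ x, x ∈ shortDiff M (g i) ∧ x ∈ shortDiff M (g j)
    · obtain ⟨j, hij, x, hxi, hxj⟩ := hex
      have hsub : shortDiff M (g i) \ shortDiff M (g j) ⊆ P i := by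
        intro y hy
        obtain ⟨hyi, hyj⟩ := mem_sdiff.1 hy
        refine mem_sdiff.2 ⟨hyi, fun hy' => ?_⟩
        obtain ⟨j', hj', hyj'⟩ := mem_biUnion.1 hy'
        have hij' : i ≠ j' := (ne_of_mem_erase hj').symm
        have := hUI.eq_of_mem_shortDiff hI hij hij' hxi hxj hyi hyj'
        exact hyj (this ▸ hyj')
      have h36 := hUI.card_common_le hI (by omega) hij (shortDiff M (g i) ∩ shortDiff M (g j)) (by
        intro y hy
        obtain ⟨k, -, hk, hky⟩ := mem_shortDiff.1 (mem_inter.1 hy).1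
        obtain ⟨l, -, hl, hly⟩ := mem_shortDiff.1 (mem_inter.1 hy).2
        exact ⟨k, l, by omega, by omega, hky, hly⟩)
      have h1 := card_le_card hsub
      have h2 := card_sdiff_add_card_inter (shortDiff M (g i)) (shortDiff M (g j))
      omega
    · push Not at hex
      have hP : P i = shortDiff M (g i) := sdiff_eq_self_of_disjoint (by
        refine Finset.disjoint_left.2 fun x hx hx' => ?_
        obtain ⟨j, hj, hxj⟩ := mem_biUnion.1 hx'
        exact hex j (ne_of_mem_erase hj).symm x hx hxj)
      rw [hP]
      omega
  calc (M - 2) * (2 * M - 42) ≤ N.card * (2 * M - 42) := Nat.mul_le_mul_right _ hNc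
    _ = ∑ _i ∈ N, (2 * M - 42) := by rw [sum_const, smul_eq_mul]
    _ ≤ ∑ i ∈ N, (P i).card := sum_le_sum hPc
    _ = (N.biUnion P).card := (card_biUnion hPdisj).symm
    _ ≤ (univ : Finset (ZMod L)).card := card_le_univ _
    _ = L := by rw [card_univ, ZMod.card]

/-- The set of admissible periods is nonempty: `p * (2 * M + 1)` belongs to it. -/
theorem exists_UI_of_prime {M p : ℕ} (hp : p.Prime) (hM : M < p) (hcop : p.Coprime (2 * M + 1)) :
    ∃ I : Fin M → Finset (ZMod (p * (2 * M + 1))),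
      UI I ∧ ∀ i, ∃ g, EquiDiff (I i) (M + 1) g := by
  have := Fact.mk hp
  let e := ZMod.chineseRemainder hcop
  let g : Fin M → ZMod (p * (2 * M + 1)) := fun i => e.symm ((i : ℕ), 1)
  have hg : ∀ i, e (g i) = (((i : ℕ) : ZMod p), 1) := fun i => e.apply_symm_apply _
  have key : ∀ (i j : Fin M) (a b a' b' : ℕ), a ≤ M → b ≤ M → a' ≤ M → b' ≤ M →
      (a : ZMod (p * (2 * M + 1))) * g i - b * g i = a' * g j - b' * g j → a ≠ b → i = j := by
    intro i j a b a' b' ha hb ha' hb' h hab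
    have h1 := congrArg e h
    simp only [map_sub, map_mul, map_natCast, hg, Prod.ext_iff, Prod.fst_sub, Prod.snd_sub,
      Prod.fst_mul, Prod.snd_mul, Prod.fst_natCast, Prod.snd_natCast, mul_one] at h1
    obtain ⟨h1, h2⟩ := h1
    have h3 : (((a : ℤ) - b - (a' - b') : ℤ) : ZMod (2 * M + 1)) = 0 := by
      push_cast
      rw [h2, sub_self]
    have h4 := Int.eq_zero_of_abs_lt_dvd ((ZMod.intCast_zmod_eq_zero_iff_dvd _ _).1 h3)
      (abs_lt.2 ⟨by push_cast; omega, by push_cast; omega⟩)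
    have h5 : ((((a : ℤ) - b) * (i - j) : ℤ) : ZMod p) = 0 := by
      have h6 : (((a : ℤ) - b : ℤ) : ZMod p) = ((a' - b' : ℤ) : ZMod p) := by
        rw [sub_eq_zero.1 h4]
      push_cast at h6 ⊢
      linear_combination h1 - (j : ZMod p) * h6
    have h7 := (ZMod.intCast_zmod_eq_zero_iff_dvd _ _).1 h5
    rcases (Nat.prime_iff_prime_int.1 hp).dvd_or_dvd h7 with h8 | h8
    · have := Int.eq_zero_of_abs_lt_dvd h8 (abs_lt.2 ⟨by omega, by omega⟩)
      omega
    · have := Int.eq_zero_of_abs_lt_dvd h8 (abs_lt.2 ⟨by omega, by omega⟩)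
      exact Fin.ext (by omega)
  have hcard : ∀ i, ((range (M + 1)).image fun t : ℕ =>
      (t : ZMod (p * (2 * M + 1))) * g i).card = M + 1 := by
    intro i
    rw [card_image_of_injOn, card_range]
    intro a ha b hb h
    simp only [coe_range, Set.mem_Iio] at ha hb
    have h1 := congrArg (fun x => (e x).2) h
    simp only [map_mul, map_natCast, hg, Prod.snd_mul, Prod.snd_natCast, mul_one] at h1
    have h2 := (ZMod.natCast_eq_natCast_iff' _ _ _).1 h1
    rwa [Nat.mod_eq_of_lt (by omega), Nat.mod_eq_of_lt (by omega)] at h2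
  refine ⟨fun i => (range (M + 1)).image fun t : ℕ => (t : ZMod (p * (2 * M + 1))) * g i, ?_,
    fun i => ⟨g i, rfl, hcard i⟩⟩
  intro i τ hsub
  have hlt : (univ.erase i).card < ((range (M + 1)).image fun t : ℕ =>
      (t : ZMod (p * (2 * M + 1))) * g i).card := by
    rw [hcard, card_erase_of_mem (mem_univ _), card_univ, Fintype.card_fin]
    omega
  have hex : ∀ x ∈ (range (M + 1)).image fun t : ℕ => (t : ZMod (p * (2 * M + 1))) * g i,
      ∃ j ∈ univ.erase i, ∃ s ≤ M, (s : ZMod (p * (2 * M + 1))) * g j + τ j = x := by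
    intro x hx
    obtain ⟨j, hj, hxj⟩ := mem_biUnion.1 (hsub hx)
    obtain ⟨y, hy, rfl⟩ := mem_image.1 hxj
    obtain ⟨s, hs, rfl⟩ := mem_image.1 hy
    exact ⟨j, hj, s, by simpa [Nat.lt_succ_iff] using hs, rfl⟩
  have : Nonempty (Fin M) := ⟨i⟩
  choose! f hf s hs hfs using hex
  obtain ⟨x, hx, y, hy, hxy, he⟩ := exists_ne_map_eq_of_card_lt_of_maps_to hlt hf
  have hx' := hfs x hx
  have hy' := hfs y hy
  rw [← he] at hy'
  obtain ⟨a, ha, hax⟩ := mem_image.1 hx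
  obtain ⟨b, hb, hby⟩ := mem_image.1 hy
  rw [mem_range] at ha hb
  refine ne_of_mem_erase (hf x hx) (key i (f x) a b (s x) (s y) (by omega) (by omega) (hs x hx)
    (hs y hy) ?_ ?_).symm
  · rw [hax, hby]
    linear_combination hy' - hx'
  · rintro rfl
    exact hxy (hax.symm.trans hby)

theorem le_LminE {M : ℕ} (hM : 2 * 36 ^ 3 ≤ M) : (M - 2) * (2 * M - 42) ≤ LminE M := by
  have hne : {L : ℕ | 0 < L ∧ ∃ I : Fin M → Finset (ZMod L),
      UI I ∧ ∀ i, ∃ g : ZMod L, EquiDiff (I i) (M + 1) g}.Nonempty := by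
    obtain ⟨p, hpM, hp⟩ := Nat.exists_infinite_primes (2 * M + 2)
    exact ⟨p * (2 * M + 1), Nat.mul_pos hp.pos (by omega), exists_UI_of_prime hp (by omega)
      (Nat.coprime_of_lt_prime (by omega) (by omega) hp)⟩
  obtain ⟨hpos, I, hUI, hI⟩ := Nat.sInf_mem hne
  choose g hg using hI
  have : NeZero (sInf {L : ℕ | 0 < L ∧ ∃ I : Fin M → Finset (ZMod L),
      UI I ∧ ∀ i, ∃ g : ZMod L, EquiDiff (I i) (M + 1) g}) := ⟨hpos.ne'⟩
  exact hUI.le_length hg hM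

theorem LminE_le_of_prime {M : ℕ} (hp : (M + 1).Prime) : LminE M ≤ (M + 1) * (2 * M + 1) := by
  refine Nat.sInf_le ⟨by positivity, exists_UI_of_prime hp (by omega) ?_⟩
  rw [Nat.Prime.coprime_iff_not_dvd hp]
  intro h
  have h1 : M + 1 ∣ 1 := by
    have := Nat.dvd_sub (Dvd.intro 2 rfl : M + 1 ∣ (M + 1) * 2) h
    rwa [show (M + 1) * 2 - (2 * M + 1) = 1 by omega] at this
  exact hp.one_lt.ne' (Nat.dvd_one.1 h1)

theorem tendsto_const_add_div_mul (a b : ℝ) : Filter.Tendsto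
    (fun M : ℕ => ((M : ℝ) + a) * (2 * M + b) / (2 * (M : ℝ) ^ 2)) Filter.atTop (nhds 1) := by
  have h1 := tendsto_const_div_atTop_nhds_zero_nat a
  have h2 := tendsto_const_div_atTop_nhds_zero_nat (b / 2)
  have h3 := (h1.const_add 1).mul (h2.const_add 1)
  simp only [add_zero, mul_one] at h3
  refine h3.congr' ?_
  filter_upwards [Filter.eventually_gt_atTop 0] with M hM
  have : (M : ℝ) ≠ 0 := by positivity
  field_simp

theorem stmt17 :
    Filter.liminf (fun M : ℕ => (LminE M : ℝ) / (2 * (M : ℝ) ^ 2)) Filter.atTop = 1 := by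
  have hbdd : Filter.IsBoundedUnder (· ≥ ·) Filter.atTop
      (fun M : ℕ => (LminE M : ℝ) / (2 * (M : ℝ) ^ 2)) :=
    Filter.isBoundedUnder_of ⟨0, fun M => by positivity⟩
  have hfreq : ∀ c > 1, ∃ᶠ M : ℕ in Filter.atTop, (LminE M : ℝ) / (2 * (M : ℝ) ^ 2) ≤ c := by
    intro c hc
    have h1 : ∃ᶠ M : ℕ in Filter.atTop, (M + 1).Prime := by
      refine Filter.frequently_atTop.2 fun n => ?_
      obtain ⟨p, hpn, hp⟩ := Nat.exists_infinite_primes (n + 1)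
      exact ⟨p - 1, by omega, by rwa [Nat.sub_add_cancel hp.one_le]⟩
    refine (h1.and_eventually ((tendsto_const_add_div_mul 1 1).eventually_lt_const hc)).mono ?_
    rintro M ⟨hp, hM⟩
    refine le_trans ?_ hM.le
    gcongr
    exact_mod_cast LminE_le_of_prime hp
  have hcob : Filter.IsCoboundedUnder (· ≥ ·) Filter.atTop
      (fun M : ℕ => (LminE M : ℝ) / (2 * (M : ℝ) ^ 2)) :=
    Filter.IsCoboundedUnder.of_frequently_le (hfreq 2 one_lt_two)
  apply le_antisymm
  · exact le_of_forall_gt_imp_ge_of_dense fun c hc =>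
      Filter.liminf_le_of_frequently_le (hfreq c hc) hbdd
  · have h := tendsto_const_add_div_mul (-2) (-42)
    rw [← h.liminf_eq]
    refine Filter.liminf_le_liminf ?_ h.isBoundedUnder_ge hcob
    filter_upwards [Filter.eventually_ge_atTop (2 * 36 ^ 3)] with M hM
    gcongr
    have h1 : (((M - 2) * (2 * M - 42) : ℕ) : ℝ) ≤ LminE M := by exact_mod_cast le_LminE hM
    rw [Nat.cast_mul, Nat.cast_sub (by omega), Nat.cast_sub (by omega)] at h1
    push_cast at h1
    linarith
end
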